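/- arXiv:1912.03892 — 10 statements merged into one kernel-verified Lean document; each statement's English description precedes it below -/
import Mathlib

section
/- Let R be a finite commutative ring, k ≥ 1, and let Ω ⊆ R^k satisfy 0 ∉ Ω and uΩ = Ω for every unit u of R. Then for every integer s > 1: Ω is an s-sum set if and only if the Cayley graph Γ(Ω) (vertex set R^k, g adjacent to h iff g − h ∈ Ω) is an s-strongly walk-regular graph. -/
/-- `Ω` is an `s`-sum set: there are constants `σ0, σ1` such that every nonzero `h`
can be written as a sum of `s` elements of `Ω` in exactly `σ0` ways if `h ∈ Ω` and
`σ1` ways otherwise. -/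
def IsSumSet {V : Type*} [AddCommMonoid V] [DecidableEq V] (Ω : Finset V) (s : ℕ) : Prop :=
  ∃ σ0 σ1 : ℕ, ∀ h : V, h ≠ 0 →
    {x : Fin s → V | (∀ i, x i ∈ Ω) ∧ ∑ i, x i = h}.ncard = if h ∈ Ω then σ0 else σ1

/-- The 0/1 adjacency matrix of the Cayley graph `Γ(Ω)`: `g` and `h` are adjacent
iff `g - h ∈ Ω`. -/
def cayleyAdj {V : Type*} [AddCommGroup V] [DecidableEq V] (Ω : Finset V) :
    Matrix V V ℕ := fun g h => if g - h ∈ Ω then 1 else 0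

/-- The entries of the `n`-th power of a Cayley adjacency matrix count the representations
of the difference as a sum of `n` elements of the connection set. -/
theorem cayleyAdj_pow_apply {V : Type*} [AddCommGroup V] [Fintype V] [DecidableEq V]
    (Ω : Finset V) (n : ℕ) (g h : V) :
    (cayleyAdj Ω ^ n) g h =
      ∑ x : Fin n → V, if (∀ i, x i ∈ Ω) ∧ ∑ i, x i = g - h then 1 else 0 := by
  induction n generalizing g with
  | zero => simp [Matrix.one_apply, eq_comm, sub_eq_zero]
  | succ n ih =>
    rw [pow_succ', Matrix.mul_apply, ← (Fin.consEquiv fun _ : Fin (n + 1) => V).sum_comp,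
      Fintype.sum_prod_type, ← (Equiv.subLeft g).sum_comp]
    refine Finset.sum_congr rfl fun y _ => ?_
    have key : ∀ z : V, y + z = g - h ↔ z = g - y - h := fun z => by
      rw [← eq_sub_iff_add_eq', sub_right_comm]
    by_cases hy : y ∈ Ω <;>
      simp [ih, cayleyAdj, Fin.consEquiv, Fin.forall_fin_succ, Fin.sum_univ_succ, hy, key]

/-- The entries of the `n`-th power of a Cayley adjacency matrix as cardinalities. -/
theorem cayleyAdj_pow_apply_eq_ncard {V : Type*} [AddCommGroup V] [Fintype V] [DecidableEq V]
    (Ω : Finset V) (n : ℕ) (g h : V) :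
    (cayleyAdj Ω ^ n) g h =
      {x : Fin n → V | (∀ i, x i ∈ Ω) ∧ ∑ i, x i = g - h}.ncard := by
  rw [cayleyAdj_pow_apply, Set.ncard_eq_toFinset_card', Set.toFinset_ofPred, Finset.card_filter]

theorem stmt0 {R : Type*} [CommRing R] [Fintype R] [DecidableEq R]
    {k : ℕ} (hk : 1 ≤ k) (Ω : Finset (Fin k → R))
    (h0 : (0 : Fin k → R) ∉ Ω)
    (hunit : ∀ u : Rˣ, Ω.image (fun x => (u : R) • x) = Ω)
    (s : ℕ) (hs : 1 < s) :
    IsSumSet Ω s ↔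
      ∃ lam mu nu : ℕ, ∀ g h : Fin k → R,
        (g - h ∈ Ω → ((cayleyAdj Ω) ^ s) g h = lam) ∧
        (g ≠ h → g - h ∉ Ω → ((cayleyAdj Ω) ^ s) g h = mu) ∧
        (g = h → ((cayleyAdj Ω) ^ s) g h = nu) := by
  simp only [cayleyAdj_pow_apply_eq_ncard]
  constructor
  · rintro ⟨σ0, σ1, H⟩
    refine ⟨σ0, σ1, {x : Fin s → Fin k → R | (∀ i, x i ∈ Ω) ∧ ∑ i, x i = 0}.ncard,
      fun g h => ⟨fun hm => ?_, fun hne hm => ?_, fun he => ?_⟩⟩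
    · rw [H _ (ne_of_mem_of_not_mem hm h0), if_pos hm]
    · rw [H _ (sub_ne_zero.2 hne), if_neg hm]
    · rw [sub_eq_zero.2 he]
  · rintro ⟨lam, mu, nu, H⟩
    refine ⟨lam, mu, fun h hh => ?_⟩
    have := H h 0
    rw [sub_zero] at this
    split_ifs with hm
    · exact this.1 hm
    · exact this.2.1 hh hm
end

section
/- Under the three-weight hypothesis on Ω ⊆ ZMod(p^m)^k: Ω is a triple sum set (3-sum set) if and only if w1 + w2 + w3 = 3·n·(p−1)·p^(m−2). -/
-- The homogeneous weight on `ZMod (p^m)`.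
open Classical in
noncomputable def hwt (p m : ℕ) (x : ZMod (p^m)) : ℕ :=
  if x = 0 then 0
  else if x ∈ Ideal.span {(p : ZMod (p^m))^(m-1)} then p^(m-1)
  else (p-1) * p^(m-2)

open Finset in
/-- The multiplicity of `h` as a sum of `s` elements of `Ω` is the `s`-fold convolution power of the
indicator of `Ω`: its character sums are the `s`-th powers of those of `Ω`. -/
theorem sum_ncard_mul_addChar {V : Type*} [AddCommGroup V] [Fintype V] [DecidableEq V]
    (Ω : Finset V) (s : ℕ) (χ : AddChar V ℂ) :
    ∑ h, (({x : Fin s → V | (∀ i, x i ∈ Ω) ∧ ∑ i, x i = h}.ncard : ℕ) : ℂ) * χ h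
      = (∑ ω ∈ Ω, χ ω) ^ s := by
  have hcard : ∀ h, {x : Fin s → V | (∀ i, x i ∈ Ω) ∧ ∑ i, x i = h}.ncard
      = #{x ∈ Fintype.piFinset fun _ : Fin s => Ω | ∑ i, x i = h} := by
    intro h
    rw [← Set.ncard_coe_finset]
    congr 1
    ext x
    simp [Fintype.mem_piFinset]
  have hpow : (∑ ω ∈ Ω, χ ω) ^ s
      = ∑ x ∈ Fintype.piFinset fun _ : Fin s => Ω, χ (∑ i, x i) := by
    have hprod : ∀ x : Fin s → V, χ (∑ i, x i) = ∏ i, χ (x i) := fun x =>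
      map_sum χ.toAddMonoidHom x univ
    simp_rw [hprod]
    rw [Finset.sum_prod_piFinset Ω (fun _ : Fin s => fun v => χ v)]
    simp
  rw [hpow, ← Finset.sum_fiberwise (s := Fintype.piFinset fun _ : Fin s => Ω)
    (g := fun x : Fin s → V => ∑ i, x i)]
  refine Finset.sum_congr rfl fun h _ => ?_
  rw [hcard, Finset.sum_congr rfl (g := fun _ => χ h), Finset.sum_const, nsmul_eq_mul]
  intro x hx
  rw [(Finset.mem_filter.1 hx).2]

/-- The additive character of `(ZMod q)^k` attached to the vector `x`. -/
noncomputable def dotChar {q k : ℕ} [NeZero q] (x : Fin k → ZMod q) :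
    AddChar (Fin k → ZMod q) ℂ where
  toFun v := ZMod.stdAddChar (∑ i, x i * v i)
  map_zero_eq_one' := by simp
  map_add_eq_mul' a b := by
    simp only [Pi.add_apply, mul_add, Finset.sum_add_distrib, AddChar.map_add_eq_mul]

theorem dotChar_apply {q k : ℕ} [NeZero q] (x v : Fin k → ZMod q) :
    dotChar x v = ZMod.stdAddChar (∑ i, x i * v i) := rfl

theorem dotChar_comm {q k : ℕ} [NeZero q] (x v : Fin k → ZMod q) :
    dotChar x v = dotChar v x := by
  simp only [dotChar_apply, mul_comm]

theorem dotChar_ne_one {q k : ℕ} [NeZero q] {x : Fin k → ZMod q} (hx : x ≠ 0) :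
    dotChar x ≠ 1 := by
  obtain ⟨i, hi⟩ := Function.ne_iff.1 hx
  obtain ⟨t, ht⟩ := AddChar.ne_one_iff.1 (ZMod.isPrimitive_stdAddChar q hi)
  refine AddChar.ne_one_iff.2 ⟨Pi.single i t, ?_⟩
  simpa [dotChar_apply, Pi.single_apply] using ht

theorem sum_dotChar {q k : ℕ} [NeZero q] {x : Fin k → ZMod q} (hx : x ≠ 0) :
    ∑ v, dotChar x v = 0 :=
  AddChar.sum_eq_zero_of_ne_one (dotChar_ne_one hx)

/-- A function all of whose nontrivial character sums vanish is constant. -/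
theorem eq_of_sum_mul_dotChar_eq_zero {q k : ℕ} [NeZero q] (F : (Fin k → ZMod q) → ℂ)
    (hF : ∀ x, x ≠ 0 → ∑ h, F h * dotChar x h = 0) (a b : Fin k → ZMod q) : F a = F b := by
  have key : ∀ a, (Fintype.card (Fin k → ZMod q) : ℂ) * F a = ∑ h, F h := by
    intro a
    have h1 : ∑ x, ∑ h, F h * dotChar x (h - a) = ∑ h, F h := by
      rw [Finset.sum_eq_single 0]
      · simp [dotChar_apply]
      · intro x _ hx
        simp_rw [sub_eq_add_neg, AddChar.map_add_eq_mul, ← mul_assoc]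
        rw [← Finset.sum_mul, hF x hx, zero_mul]
      · simp
    rw [← h1, Finset.sum_comm, Finset.sum_eq_single a]
    · simp [mul_comm]
    · intro h _ hh
      simp_rw [dotChar_comm _ (h - a)]
      rw [← Finset.mul_sum, sum_dotChar (sub_ne_zero.2 hh), mul_zero]
    · simp
  have h0 : (Fintype.card (Fin k → ZMod q) : ℂ) ≠ 0 := Nat.cast_ne_zero.2 Fintype.card_ne_zero
  exact mul_left_cancel₀ h0 ((key a).trans (key b).symm)

theorem mul_prime_eq_zero_iff {p m : ℕ} [Fact p.Prime] (hm : 1 ≤ m) (a : ZMod (p ^ m)) :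
    (p : ZMod (p ^ m)) * a = 0 ↔ a ∈ Ideal.span {(p : ZMod (p ^ m)) ^ (m - 1)} := by
  have hp : 0 < p := (Fact.out : p.Prime).pos
  have hpm : p ^ m = p * p ^ (m - 1) := by rw [← pow_succ', Nat.sub_add_cancel hm]
  rw [Ideal.mem_span_singleton]
  constructor
  · intro h
    have h1 : ((p * a.val : ℕ) : ZMod (p ^ m)) = 0 := by simpa using h
    obtain ⟨c, hc⟩ := Nat.dvd_of_mul_dvd_mul_left hp
      (hpm.symm.dvd.trans ((ZMod.natCast_eq_zero_iff _ _).1 h1))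
    refine ⟨c, ?_⟩
    conv_lhs => rw [← ZMod.natCast_zmod_val a, hc]
    push_cast
    rfl
  · rintro ⟨c, rfl⟩
    rw [← mul_assoc, ← Nat.cast_pow, ← Nat.cast_mul, ← hpm, ZMod.natCast_self, zero_mul]

theorem prime_dvd_of_not_isUnit {p m : ℕ} [Fact p.Prime] {b : ZMod (p ^ m)} (hb : ¬ IsUnit b) :
    (p : ZMod (p ^ m)) ∣ b := by
  rw [← ZMod.natCast_zmod_val b, ZMod.isUnit_iff_coprime] at hb
  have h : ¬ Nat.Coprime b.val p := fun h => hb (h.pow_right m)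
  rw [Nat.coprime_comm, (Fact.out : p.Prime).coprime_iff_not_dvd, not_not] at h
  obtain ⟨c, hc⟩ := h
  exact ⟨c, by rw [← ZMod.natCast_zmod_val b, hc]; push_cast; rfl⟩

open Finset in
theorem sum_units_add_sum_nonunits {p m : ℕ} [Fact p.Prime] (f : ZMod (p ^ m) → ℂ) :
    ∑ u : (ZMod (p ^ m))ˣ, f u + ∑ b ∈ univ with ¬ IsUnit b, f b = ∑ b, f b := by
  classical
  rw [← Finset.sum_filter_add_sum_filter_not univ (fun b : ZMod (p ^ m) => IsUnit b) f]
  congr 1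
  refine Finset.sum_bij (fun u _ => (u : ZMod (p ^ m))) ?_ ?_ ?_ ?_
  · simp
  · intro a _ b _ h
    exact Units.ext h
  · intro b hb
    obtain ⟨u, hu⟩ := (Finset.mem_filter.1 hb).2
    exact ⟨u, by simp, hu⟩
  · simp

theorem card_units_zmod_prime_pow {p m : ℕ} [Fact p.Prime] (hm : 1 ≤ m) :
    (Fintype.card (ZMod (p ^ m))ˣ : ℂ) = p ^ (m - 1) * (p - 1) := by
  rw [ZMod.card_units_eq_totient, Nat.totient_prime_pow Fact.out hm]
  push_cast [Nat.cast_sub (Fact.out : p.Prime).one_le]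
  rfl

open Finset in
theorem sum_nonunits_stdAddChar {p m : ℕ} [Fact p.Prime] (hm : 1 ≤ m) (a : ZMod (p ^ m)) :
    ∑ b ∈ univ with ¬ IsUnit b, (ZMod.stdAddChar (b * a) : ℂ)
      = if (p : ZMod (p ^ m)) * a = 0 then (p : ℂ) ^ (m - 1) else 0 := by
  split_ifs with h
  · have h1 : ∀ b ∈ univ.filter (fun b : ZMod (p ^ m) => ¬ IsUnit b),
        (ZMod.stdAddChar (b * a) : ℂ) = 1 := by
      intro b hb
      obtain ⟨c, rfl⟩ := prime_dvd_of_not_isUnit (Finset.mem_filter.1 hb).2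
      rw [mul_right_comm, h, zero_mul, AddChar.map_zero_eq_one]
    rw [Finset.sum_congr rfl h1]
    have h2 := sum_units_add_sum_nonunits (p := p) (m := m) (fun _ => 1)
    have h3 : (p : ℂ) ^ m = p ^ (m - 1) * p := by rw [← pow_succ, Nat.sub_add_cancel hm]
    simp only [Finset.sum_const, Finset.card_univ, ZMod.card, nsmul_eq_mul, mul_one,
      card_units_zmod_prime_pow hm] at h2 ⊢
    push_cast at h2
    linear_combination h2 + h3
  · have hnil : IsNilpotent (p : ZMod (p ^ m)) :=
      ⟨m, by rw [← Nat.cast_pow, ZMod.natCast_self]⟩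
    have hu : ∀ b : ZMod (p ^ m), IsUnit (b + p) ↔ IsUnit b := fun b =>
      ⟨fun h => by simpa using hnil.neg.isUnit_add_left_of_commute h (Commute.all _ _),
        fun h => hnil.isUnit_add_left_of_commute h (Commute.all _ _)⟩
    have hshift : ∑ b ∈ univ with ¬ IsUnit b, (ZMod.stdAddChar (b * a) : ℂ)
        = ∑ b : ZMod (p ^ m) with ¬ IsUnit b,
            (ZMod.stdAddChar ((b + (p : ZMod (p ^ m))) * a) : ℂ) := by
      refine (Finset.sum_equiv (Equiv.addRight (p : ZMod (p ^ m))) ?_ ?_).symm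
      · intro b
        simp [hu]
      · simp
    simp_rw [add_mul, AddChar.map_add_eq_mul] at hshift
    rw [← Finset.sum_mul] at hshift
    have hne : (ZMod.stdAddChar ((p : ZMod (p ^ m)) * a) : ℂ) ≠ 1 := by
      intro h1
      exact h (ZMod.injective_stdAddChar (by rw [h1, AddChar.map_zero_eq_one]))
    have : (∑ b ∈ univ with ¬ IsUnit b, (ZMod.stdAddChar (b * a) : ℂ))
        * (ZMod.stdAddChar ((p : ZMod (p ^ m)) * a) - 1) = 0 := by
      linear_combination -hshift
    exact (mul_eq_zero.1 this).resolve_right (sub_ne_zero.2 hne)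

/-- The homogeneous weight in terms of the Ramanujan sum `∑ u, ψ (u * a)`. -/
theorem prime_mul_hwt {p m : ℕ} [Fact p.Prime] (hm : 2 ≤ m) (a : ZMod (p ^ m)) :
    (p : ℂ) * hwt p m a
      = p ^ (m - 1) * (p - 1)
        - ∑ u : (ZMod (p ^ m))ˣ, (ZMod.stdAddChar ((u : ZMod (p ^ m)) * a) : ℂ) := by
  have h1 := sum_units_add_sum_nonunits (p := p) (m := m) (fun b => ZMod.stdAddChar (b * a))
  rw [sum_nonunits_stdAddChar (by omega),
    AddChar.sum_mulShift a (ZMod.isPrimitive_stdAddChar (p ^ m)), ZMod.card] at h1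
  have e1 : (p : ℂ) ^ m = p * p ^ (m - 1) := by rw [← pow_succ', Nat.sub_add_cancel (by omega)]
  have e2 : (p : ℂ) ^ (m - 1) = p * p ^ (m - 2) := by
    rw [← pow_succ']; congr 1; omega
  rw [eq_sub_of_add_eq h1, hwt, ← mul_prime_eq_zero_iff (by omega)]
  split_ifs with ha hpa hpa
  · push_cast
    linear_combination e1
  · simp [ha] at hpa
  · push_cast
    ring
  · push_cast [Nat.cast_sub (Fact.out : p.Prime).one_le]
    linear_combination (1 - (p : ℂ)) * e2

/-- The character sum of a unit-stable set determines the homogeneous weight of the dual codeword. -/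
theorem prime_mul_sum_hwt {p m k : ℕ} [Fact p.Prime] (hm : 2 ≤ m)
    (Ω : Finset (Fin k → ZMod (p ^ m)))
    (hunit : ∀ u : (ZMod (p ^ m))ˣ, Ω.image (fun x => (u : ZMod (p ^ m)) • x) = Ω)
    (x : Fin k → ZMod (p ^ m)) :
    (p : ℂ) * (∑ ω ∈ Ω, hwt p m (∑ i, x i * ω i) : ℕ)
      = p ^ (m - 1) * (p - 1) * (Ω.card - ∑ ω ∈ Ω, dotChar x ω) := by
  have hsum : ∀ u : (ZMod (p ^ m))ˣ,
      ∑ ω ∈ Ω, (ZMod.stdAddChar ((u : ZMod (p ^ m)) * ∑ i, x i * ω i) : ℂ)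
        = ∑ ω ∈ Ω, dotChar x ω := by
    intro u
    conv_rhs => rw [← hunit u]
    rw [Finset.sum_image fun a _ b _ (h : (u : ZMod (p ^ m)) • a = (u : ZMod (p ^ m)) • b) =>
      smul_left_cancel u h]
    refine Finset.sum_congr rfl fun ω _ => ?_
    rw [dotChar_apply, Finset.mul_sum]
    congr 2
    ext i
    simp only [Pi.smul_apply, smul_eq_mul]
    ring
  push_cast
  rw [Finset.mul_sum]
  simp_rw [prime_mul_hwt hm]
  rw [Finset.sum_sub_distrib, Finset.sum_comm]
  simp_rw [hsum]
  simp only [Finset.sum_const, Finset.card_univ, nsmul_eq_mul,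
    card_units_zmod_prime_pow (p := p) (m := m) (by omega)]
  ring

open Finset in
/-- In a triple sum set, the nontrivial character sums are roots of a depressed cubic. -/
theorem IsSumSet.exists_cubic {q k : ℕ} [NeZero q] {Ω : Finset (Fin k → ZMod q)}
    (h0 : 0 ∉ Ω) (hΩ : IsSumSet Ω 3) :
    ∃ a b : ℂ, ∀ x : Fin k → ZMod q, x ≠ 0 →
      (∑ ω ∈ Ω, dotChar x ω) ^ 3 = a * ∑ ω ∈ Ω, dotChar x ω + b := by
  obtain ⟨σ0, σ1, hσ⟩ := hΩ
  set T : (Fin k → ZMod q) → ℕ :=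
    fun h => {x : Fin 3 → _ | (∀ i, x i ∈ Ω) ∧ ∑ i, x i = h}.ncard with hT
  refine ⟨σ0 - σ1, T 0 - σ1, fun x hx => ?_⟩
  rw [← sum_ncard_mul_addChar]
  have hterm : ∀ h, (T h : ℂ) * dotChar x h
      = σ1 * dotChar x h + (if h ∈ Ω then (σ0 - σ1 : ℂ) * dotChar x h else 0)
        + (if h = 0 then (T 0 - σ1 : ℂ) else 0) := by
    intro h
    by_cases hh : h = 0
    · subst hh
      simp [h0]
    · have := hσ h hh
      rw [show T h = _ from this]
      split_ifs <;> ring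
  rw [Finset.sum_congr rfl fun h _ => hterm h, Finset.sum_add_distrib, Finset.sum_add_distrib,
    ← Finset.mul_sum, sum_dotChar hx, Finset.sum_ite_mem, Finset.univ_inter, ← Finset.mul_sum]
  simp

open Finset in
/-- If the nontrivial character sums are roots of a depressed cubic, then the set is a triple sum
set. -/
theorem isSumSet_three_of_cubic {q k : ℕ} [NeZero q] {Ω : Finset (Fin k → ZMod q)} (a b : ℂ)
    (hab : ∀ x : Fin k → ZMod q, x ≠ 0 →
      (∑ ω ∈ Ω, dotChar x ω) ^ 3 = a * ∑ ω ∈ Ω, dotChar x ω + b) : IsSumSet Ω 3 := by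
  classical
  set T : (Fin k → ZMod q) → ℕ :=
    fun h => {x : Fin 3 → _ | (∀ i, x i ∈ Ω) ∧ ∑ i, x i = h}.ncard with hT
  have hconst := eq_of_sum_mul_dotChar_eq_zero
    (fun h => (T h : ℂ) - (if h ∈ Ω then a else 0) - (if h = 0 then b else 0)) (by
      intro x hx
      simp_rw [sub_mul, ite_mul, zero_mul]
      rw [Finset.sum_sub_distrib, Finset.sum_sub_distrib, sum_ncard_mul_addChar, hab x hx,
        Finset.sum_ite_mem, Finset.univ_inter, ← Finset.mul_sum]
      simp)
  have heq : ∀ g h, g ≠ 0 → h ≠ 0 → (g ∈ Ω ↔ h ∈ Ω) → T g = T h := by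
    intro g h hg hh hgh
    have := hconst g h
    simp only [hg, hh, hgh, if_false, sub_zero, sub_left_inj] at this
    exact_mod_cast this
  refine ⟨if h : ∃ g, g ≠ 0 ∧ g ∈ Ω then T h.choose else 0,
    if h : ∃ g, g ≠ 0 ∧ g ∉ Ω then T h.choose else 0, fun h hh => ?_⟩
  change T h = _
  split_ifs with h1 h2 h2
  · exact heq _ _ hh h2.choose_spec.1 (iff_of_true h1 h2.choose_spec.2)
  · exact absurd ⟨h, hh, h1⟩ h2
  · exact heq _ _ hh h2.choose_spec.1 (iff_of_false h1 h2.choose_spec.2)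
  · exact absurd ⟨h, hh, h1⟩ h2

/-- Three distinct roots of a depressed cubic sum to zero. -/
theorem add_add_eq_zero_of_cubic {K : Type*} [Field K] {x y z a b : K}
    (hxy : x ≠ y) (hxz : x ≠ z) (hyz : y ≠ z) (hx : x ^ 3 = a * x + b) (hy : y ^ 3 = a * y + b)
    (hz : z ^ 3 = a * z + b) : x + y + z = 0 := by
  have h1 : x ^ 2 + x * y + y ^ 2 = a :=
    mul_left_cancel₀ (sub_ne_zero.2 hxy) (by linear_combination hx - hy)
  have h2 : x ^ 2 + x * z + z ^ 2 = a :=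
    mul_left_cancel₀ (sub_ne_zero.2 hxz) (by linear_combination hx - hz)
  exact mul_left_cancel₀ (sub_ne_zero.2 hyz) (by linear_combination h1 - h2)

theorem stmt2 (p m : ℕ) [Fact p.Prime] (hm : 2 ≤ m)
    {k : ℕ} (hk : 1 ≤ k) (Ω : Finset (Fin k → ZMod (p^m)))
    (h0 : (0 : Fin k → ZMod (p^m)) ∉ Ω)
    (hunit : ∀ u : (ZMod (p^m))ˣ, Ω.image (fun x => (u : ZMod (p^m)) • x) = Ω)
    (hreg : ∀ ω ∈ Ω, ∃ i, IsUnit (ω i))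
    (hspan : Submodule.span (ZMod (p^m)) (Ω : Set (Fin k → ZMod (p^m))) = ⊤)
    (n : ℕ) (hn : Ω.card = n * (p - 1) * p^(m-1))
    (w1 w2 w3 : ℕ) (hw1 : 0 < w1) (h12 : w1 < w2) (h23 : w2 < w3)
    -- three-weight hypothesis: the homogeneous weight `W x` of the dual codeword
    -- determined by a nonzero `x`, i.e. `(∑ ω ∈ Ω, hwt (x·ω)) / ((p-1)p^(m-1))`,
    -- takes exactly the values `w1, w2, w3`
    (hW : (fun x : Fin k → ZMod (p^m) => ∑ ω ∈ Ω, hwt p m (∑ i, x i * ω i)) ''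
            {x | x ≠ 0}
          = {w1 * ((p - 1) * p^(m-1)), w2 * ((p - 1) * p^(m-1)),
             w3 * ((p - 1) * p^(m-1))}) :
    IsSumSet Ω 3 ↔ w1 + w2 + w3 = 3 * n * (p - 1) * p^(m-2) := by
  have hp : p.Prime := Fact.out
  have hp0 : (p : ℂ) ≠ 0 := Nat.cast_ne_zero.2 hp.ne_zero
  have hcast : ((p - 1 : ℕ) : ℂ) = p - 1 := by push_cast [Nat.cast_sub hp.one_le]; rfl
  have hp1 : (p : ℂ) - 1 ≠ 0 := by
    rw [← hcast]
    exact Nat.cast_ne_zero.2 (Nat.sub_ne_zero_of_lt hp.one_lt)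
  have hval : ∀ (x : Fin k → ZMod (p ^ m)) (w : ℕ),
      ∑ ω ∈ Ω, hwt p m (∑ i, x i * ω i) = w * ((p - 1) * p ^ (m - 1)) →
      ∑ ω ∈ Ω, dotChar x ω = Ω.card - p * w := by
    intro x w hw
    have h := prime_mul_sum_hwt hm Ω hunit x
    rw [hw] at h
    push_cast [hcast] at h
    refine mul_left_cancel₀ (mul_ne_zero (pow_ne_zero (m - 1) hp0) hp1) ?_
    linear_combination h
  have hattained : ∀ w : ℕ, w = w1 ∨ w = w2 ∨ w = w3 →
      ∃ x : Fin k → ZMod (p ^ m), x ≠ 0 ∧ ∑ ω ∈ Ω, dotChar x ω = Ω.card - p * w := by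
    intro w hw
    have hmem : w * ((p - 1) * p ^ (m - 1)) ∈ ({w1 * ((p - 1) * p ^ (m - 1)),
        w2 * ((p - 1) * p ^ (m - 1)), w3 * ((p - 1) * p ^ (m - 1))} : Set ℕ) := by
      rcases hw with rfl | rfl | rfl <;> simp
    rw [← hW] at hmem
    obtain ⟨x, hx, hxw⟩ := hmem
    exact ⟨x, hx, hval x w hxw⟩
  have hcond : w1 + w2 + w3 = 3 * n * (p - 1) * p ^ (m - 2) ↔
      ((Ω.card - p * w1) + (Ω.card - p * w2) + (Ω.card - p * w3) : ℂ) = 0 := by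
    have hN : 3 * Ω.card = p * (3 * n * (p - 1) * p ^ (m - 2)) := by
      rw [hn, show m - 1 = m - 2 + 1 by omega, pow_succ]
      ring
    have hN' : (3 * Ω.card : ℂ) = p * (3 * n * (p - 1) * p ^ (m - 2) : ℕ) := by
      exact_mod_cast hN
    rw [← Nat.cast_inj (R := ℂ)]
    constructor
    · intro h
      rw [← h] at hN'
      push_cast at hN'
      linear_combination hN'
    · intro h
      refine mul_left_cancel₀ hp0 ?_
      rw [← hN']
      push_cast
      linear_combination -h
  rw [hcond]
  constructor
  · intro hΩ
    obtain ⟨a, b, hab⟩ := hΩ.exists_cubic h0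
    have hroot : ∀ w : ℕ, w = w1 ∨ w = w2 ∨ w = w3 →
        (Ω.card - p * w : ℂ) ^ 3 = a * (Ω.card - p * w) + b := by
      intro w hw
      obtain ⟨x, hx, hxw⟩ := hattained w hw
      rw [← hxw]
      exact hab x hx
    have hne : ∀ v w : ℕ, v < w → (Ω.card - p * v : ℂ) ≠ Ω.card - p * w := by
      intro v w hvw h
      exact hvw.ne (Nat.cast_injective (mul_left_cancel₀ hp0 (sub_right_injective h)))
    exact add_add_eq_zero_of_cubic (hne _ _ h12) (hne _ _ (h12.trans h23)) (hne _ _ h23)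
      (hroot w1 (by simp)) (hroot w2 (by simp)) (hroot w3 (by simp))
  · intro hsum
    set r : ℂ := Ω.card - p * w1
    set s : ℂ := Ω.card - p * w2
    set t : ℂ := Ω.card - p * w3
    refine isSumSet_three_of_cubic (-(r * s + r * t + s * t)) (r * s * t) fun x hx => ?_
    have hmem : ∑ ω ∈ Ω, hwt p m (∑ i, x i * ω i) ∈ ({w1 * ((p - 1) * p ^ (m - 1)),
        w2 * ((p - 1) * p ^ (m - 1)), w3 * ((p - 1) * p ^ (m - 1))} : Set ℕ) := by
      rw [← hW]
      exact ⟨x, hx, rfl⟩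
    rcases hmem with h | h | h
    · rw [hval x w1 h]
      linear_combination r ^ 2 * hsum
    · rw [hval x w2 h]
      linear_combination s ^ 2 * hsum
    · rw [hval x w3 h]
      linear_combination t ^ 2 * hsum
end

section
/- Under the three-weight hypothesis on Ω ⊆ ZMod(p^m)^k: if w2 = n·(p−1)·p^(m−2) and w1 + w3 = 2·n·(p−1)·p^(m−2), then Ω is an s-sum set for every odd integer s > 1. -/
lemma AddChar.map_sum_eq_prod {A M κ : Type*} [AddCommMonoid A] [CommMonoid M]
    (χ : AddChar A M) (t : Finset κ) (f : κ → A) :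
    χ (∑ i ∈ t, f i) = ∏ i ∈ t, χ (f i) := by
  classical
  induction t using Finset.induction_on with
  | empty => simp
  | insert i t hi ih => rw [Finset.sum_insert hi, Finset.prod_insert hi, map_add_eq_mul, ih]

section Fourier

variable {R ι : Type*} [CommRing R] [Fintype R] [DecidableEq R] [Fintype ι] [DecidableEq ι]

/-- Orthogonality relation for a primitive additive character on `ι → R`. -/
lemma sum_addChar_dotProduct {χ : AddChar R ℂ} (hχ : χ.IsPrimitive) (v : ι → R) :
    ∑ y : ι → R, χ (y ⬝ᵥ v) = if v = 0 then (Fintype.card (ι → R) : ℂ) else 0 := by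
  split_ifs with hv
  · simp [hv]
  · obtain ⟨i, hi⟩ := Function.ne_iff.mp hv
    obtain ⟨r, hr⟩ := AddChar.ne_one_iff.mp (hχ hi)
    let ψ : AddChar (ι → R) ℂ :=
      { toFun := fun y => χ (y ⬝ᵥ v)
        map_zero_eq_one' := by simp
        map_add_eq_mul' := fun y z => by rw [add_dotProduct, AddChar.map_add_eq_mul] }
    refine AddChar.sum_eq_zero_of_ne_one (ψ := ψ) (AddChar.ne_one_iff.mpr ⟨Pi.single i r, ?_⟩)
    change χ (Pi.single i r ⬝ᵥ v) ≠ 1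
    rwa [single_dotProduct, mul_comm, ← AddChar.mulShift_apply]

/-- Fourier inversion for the number of representations as a sum of `s` elements of `Ω`. -/
lemma card_mul_ncard_sum_eq {χ : AddChar R ℂ} (hχ : χ.IsPrimitive) (Ω : Finset (ι → R))
    (s : ℕ) (h : ι → R) :
    (Fintype.card (ι → R) : ℂ) *
        ({x : Fin s → ι → R | (∀ i, x i ∈ Ω) ∧ ∑ i, x i = h}.ncard : ℂ) =
      ∑ y : ι → R, (∑ ω ∈ Ω, χ (y ⬝ᵥ ω)) ^ s * χ (y ⬝ᵥ (-h)) := by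
  have hset : {x : Fin s → ι → R | (∀ i, x i ∈ Ω) ∧ ∑ i, x i = h} =
      ↑((Fintype.piFinset fun _ : Fin s => Ω).filter fun x => ∑ i, x i = h) := by
    ext x; simp
  have hpow (y : ι → R) : (∑ ω ∈ Ω, χ (y ⬝ᵥ ω)) ^ s * χ (y ⬝ᵥ (-h)) =
      ∑ x ∈ Fintype.piFinset fun _ : Fin s => Ω, χ (y ⬝ᵥ (∑ i, x i - h)) := by
    rw [Finset.sum_pow', Finset.sum_mul]
    refine Finset.sum_congr rfl fun x _ => ?_
    rw [sub_eq_add_neg, dotProduct_add, AddChar.map_add_eq_mul, dotProduct_sum,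
      AddChar.map_sum_eq_prod]
  simp_rw [hpow]
  rw [Finset.sum_comm, hset, Set.ncard_coe_finset, Finset.card_filter]
  simp_rw [sum_addChar_dotProduct hχ, sub_eq_zero]
  rw [Nat.cast_sum, Finset.mul_sum]
  exact Finset.sum_congr rfl fun x _ => by split_ifs <;> simp

/-- If the nontrivial character sums over `Ω` satisfy `λ ^ s = c * λ`, then `Ω` is an `s`-sum
set. -/
lemma isSumSet_of_pow_eq_mul {χ : AddChar R ℂ} (hχ : χ.IsPrimitive) (Ω : Finset (ι → R))
    (s : ℕ) (c : ℂ)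
    (hc : ∀ y : ι → R, y ≠ 0 → (∑ ω ∈ Ω, χ (y ⬝ᵥ ω)) ^ s = c * ∑ ω ∈ Ω, χ (y ⬝ᵥ ω)) :
    IsSumSet Ω s := by
  have hcount (h : ι → R) : (Fintype.card (ι → R) : ℂ) *
      ({x : Fin s → ι → R | (∀ i, x i ∈ Ω) ∧ ∑ i, x i = h}.ncard : ℂ) =
      c * (if h ∈ Ω then (Fintype.card (ι → R) : ℂ) else 0) +
        ((Ω.card : ℂ) ^ s - c * Ω.card) := by
    have hind : ∑ y : ι → R, (∑ ω ∈ Ω, χ (y ⬝ᵥ ω)) * χ (y ⬝ᵥ (-h)) =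
        if h ∈ Ω then (Fintype.card (ι → R) : ℂ) else 0 := by
      simp_rw [Finset.sum_mul, ← AddChar.map_add_eq_mul, ← dotProduct_add]
      rw [Finset.sum_comm]
      simp_rw [sum_addChar_dotProduct hχ, add_neg_eq_zero]
      rw [Finset.sum_ite_eq']
    rw [card_mul_ncard_sum_eq hχ, ← hind, Finset.mul_sum, ← sub_eq_iff_eq_add',
      ← Finset.sum_sub_distrib, Finset.sum_eq_single 0]
    · simp
    · intro y _ hy
      rw [hc y hy]; ring
    · simp
  have hcard : (Fintype.card (ι → R) : ℂ) ≠ 0 := Nat.cast_ne_zero.mpr Fintype.card_ne_zero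
  have heq (h h' : ι → R) (hh : h ∈ Ω ↔ h' ∈ Ω) :
      {x : Fin s → ι → R | (∀ i, x i ∈ Ω) ∧ ∑ i, x i = h}.ncard =
        {x : Fin s → ι → R | (∀ i, x i ∈ Ω) ∧ ∑ i, x i = h'}.ncard := by
    have := hcount h
    rw [if_congr hh rfl rfl, ← hcount h'] at this
    exact_mod_cast mul_left_cancel₀ hcard this
  have hex (P : Prop) : ∃ σ : ℕ, ∀ h : ι → R, (h ∈ Ω ↔ P) →
      {x : Fin s → ι → R | (∀ i, x i ∈ Ω) ∧ ∑ i, x i = h}.ncard = σ := by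
    by_cases hP : ∃ h' : ι → R, h' ∈ Ω ↔ P
    · obtain ⟨h', hh'⟩ := hP
      exact ⟨_, fun h hh => heq h h' (hh.trans hh'.symm)⟩
    · exact ⟨0, fun h hh => absurd ⟨h, hh⟩ hP⟩
  obtain ⟨σ0, hσ0⟩ := hex True
  obtain ⟨σ1, hσ1⟩ := hex False
  refine ⟨σ0, σ1, fun h _ => ?_⟩
  split_ifs with hh
  · exact hσ0 h (iff_true_intro hh)
  · exact hσ1 h (iff_false_intro hh)

end Fourier

lemma ZMod.isUnit_iff_not_dvd_of_prime_pow {p m : ℕ} [Fact p.Prime] (hm : m ≠ 0)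
    (r : ZMod (p ^ m)) : IsUnit r ↔ ¬ (p : ZMod (p ^ m)) ∣ r := by
  have hp : p.Prime := Fact.out
  constructor
  · intro hr hdvd
    have hu := isUnit_of_dvd_unit hdvd hr
    rw [ZMod.isUnit_iff_coprime, Nat.coprime_pow_right_iff (Nat.pos_of_ne_zero hm),
      Nat.coprime_self] at hu
    exact hp.one_lt.ne' hu
  · intro hr
    rw [← ZMod.natCast_zmod_val r] at hr ⊢
    rw [ZMod.isUnit_iff_coprime]
    refine Nat.Coprime.pow_right _ (Nat.Coprime.symm ((hp.coprime_iff_not_dvd).mpr fun hd => ?_))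
    exact hr (Nat.cast_dvd_cast hd)

lemma ZMod.mem_span_pow_of_mul_eq_zero {p m : ℕ} [Fact p.Prime] (hm : m ≠ 0)
    {y : ZMod (p ^ m)} (hy : (p : ZMod (p ^ m)) * y = 0) :
    y ∈ Ideal.span {(p : ZMod (p ^ m)) ^ (m - 1)} := by
  have hp : p.Prime := Fact.out
  rw [Ideal.mem_span_singleton, ← ZMod.natCast_zmod_val y, ← Nat.cast_pow]
  refine Nat.cast_dvd_cast ?_
  rw [← ZMod.natCast_zmod_val y, ← Nat.cast_mul, ZMod.natCast_eq_zero_iff] at hy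
  refine Nat.dvd_of_mul_dvd_mul_left hp.pos ?_
  rwa [← pow_succ', Nat.sub_one_add_one hm]

lemma sum_units_eq_sum_filter_isUnit {M A : Type*} [Monoid M] [Fintype M] [Fintype Mˣ]
    [DecidablePred (IsUnit : M → Prop)] [AddCommMonoid A] (f : M → A) :
    ∑ u : Mˣ, f u = ∑ r : M with IsUnit r, f r := by
  refine Finset.sum_bij (fun u _ => (u : M)) (by simp) (fun _ _ _ _ h => Units.ext h) ?_
    (fun _ _ => rfl)
  intro r hr
  obtain ⟨u, rfl⟩ := (Finset.mem_filter.mp hr).2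
  exact ⟨u, Finset.mem_univ _, rfl⟩

/-- The sum of a primitive character over the unit multiples of `y` in terms of the homogeneous
weight of `y`. -/
lemma sum_units_addChar_eq_sub_hwt {p m : ℕ} [Fact p.Prime] (hm : 2 ≤ m)
    {χ : AddChar (ZMod (p ^ m)) ℂ} (hχ : χ.IsPrimitive) (y : ZMod (p ^ m)) :
    ∑ u : (ZMod (p ^ m))ˣ, χ (u * y) = (Fintype.card (ZMod (p ^ m))ˣ : ℂ) - p * hwt p m y := by
  classical
  have hp : p.Prime := Fact.out
  have hm0 : m ≠ 0 := by omega
  have hpp : p * p ^ (m - 1) = p ^ m := by rw [← pow_succ', Nat.sub_one_add_one hm0]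
  have hcardu : Fintype.card (ZMod (p ^ m))ˣ = p ^ (m - 1) * (p - 1) := by
    rw [ZMod.card_units_eq_totient, Nat.totient_prime_pow hp (by omega)]
  by_cases hy0 : y = 0
  · simp [hy0, hwt]
  have htotal : ∑ r : ZMod (p ^ m) with IsUnit r, χ (r * y) +
      ∑ r : ZMod (p ^ m) with ¬ IsUnit r, χ (r * y) = 0 := by
    rw [Finset.sum_filter_add_sum_filter_not]
    simpa [hy0] using AddChar.sum_mulShift y hχ
  rw [sum_units_eq_sum_filter_isUnit fun r => χ (r * y), eq_neg_of_add_eq_zero_left htotal]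
  by_cases hy : y ∈ Ideal.span {(p : ZMod (p ^ m)) ^ (m - 1)}
  · obtain ⟨z, rfl⟩ := Ideal.mem_span_singleton.mp hy
    have hone : ∀ r ∈ Finset.univ.filter (fun r : ZMod (p ^ m) => ¬ IsUnit r),
        χ (r * ((p : ZMod (p ^ m)) ^ (m - 1) * z)) = 1 := by
      intro r hr
      have hr' := (Finset.mem_filter.mp hr).2
      rw [ZMod.isUnit_iff_not_dvd_of_prime_pow hm0, not_not] at hr'
      obtain ⟨t, rfl⟩ := hr'
      have hz : (p : ZMod (p ^ m)) * (p : ZMod (p ^ m)) ^ (m - 1) = 0 := by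
        exact_mod_cast (congrArg (Nat.cast : ℕ → ZMod (p ^ m)) hpp).trans (ZMod.natCast_self _)
      rw [show (p : ZMod (p ^ m)) * t * ((p : ZMod (p ^ m)) ^ (m - 1) * z) =
        (p : ZMod (p ^ m)) * (p : ZMod (p ^ m)) ^ (m - 1) * (t * z) by ring, hz, zero_mul,
        AddChar.map_zero_eq_one]
    have hcard : Fintype.card (ZMod (p ^ m))ˣ +
        (Finset.univ.filter fun r : ZMod (p ^ m) => ¬ IsUnit r).card = p ^ m := by
      have h := Finset.card_filter_add_card_filter_not (s := Finset.univ)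
        (fun r : ZMod (p ^ m) => IsUnit r)
      rw [Finset.card_univ, ZMod.card] at h
      rwa [Finset.card_eq_sum_ones, ← sum_units_eq_sum_filter_isUnit fun _ => 1,
        ← Fintype.card_eq_sum_ones] at h
    rw [Finset.sum_congr rfl hone, hwt, if_neg hy0, if_pos hy]
    simp only [Finset.sum_const, nsmul_eq_mul, mul_one]
    rw [← Nat.cast_mul, hpp]
    have hcard' := congrArg (Nat.cast : ℕ → ℂ) hcard
    rw [Nat.cast_add] at hcard'
    linear_combination -hcard'
  · have hne : y * (p : ZMod (p ^ m)) ≠ 0 := fun h =>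
      hy (ZMod.mem_span_pow_of_mul_eq_zero hm0 (by rwa [mul_comm]))
    obtain ⟨t, ht⟩ := AddChar.ne_one_iff.mp (hχ hne)
    have hshift : ∑ r : ZMod (p ^ m) with ¬ IsUnit r, χ (r * y) =
        χ (y * p * t) * ∑ r : ZMod (p ^ m) with ¬ IsUnit r, χ (r * y) := by
      rw [Finset.mul_sum]
      refine (Finset.sum_equiv (Equiv.addRight ((p : ZMod (p ^ m)) * t)) ?_ ?_).symm
      · intro r
        simp only [Finset.mem_filter_univ, ZMod.isUnit_iff_not_dvd_of_prime_pow hm0, not_not,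
          Equiv.coe_addRight]
        exact (dvd_add_left (dvd_mul_right _ _)).symm
      · intro r _
        rw [Equiv.coe_addRight, ← AddChar.map_add_eq_mul]
        congr 1
        ring
    have hzero : ∑ r : ZMod (p ^ m) with ¬ IsUnit r, χ (r * y) = 0 := by
      by_contra hne0
      exact ht (mul_right_cancel₀ hne0 (by rw [one_mul]; exact hshift.symm))
    have hpm : p * p ^ (m - 2) = p ^ (m - 1) := by rw [← pow_succ']; congr 1; omega
    have hw : p * hwt p m y = Fintype.card (ZMod (p ^ m))ˣ := by
      rw [hwt, if_neg hy0, if_neg hy, hcardu, ← hpm]; ring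
    rw [hzero, ← hw]
    push_cast
    ring

/-- Character sums over a unit-stable set are determined by homogeneous weights. -/
lemma card_units_mul_sum_addChar {p m : ℕ} [Fact p.Prime] (hm : 2 ≤ m) {ι : Type*} [Fintype ι]
    [DecidableEq ι] {χ : AddChar (ZMod (p ^ m)) ℂ} (hχ : χ.IsPrimitive)
    (Ω : Finset (ι → ZMod (p ^ m)))
    (hunit : ∀ u : (ZMod (p ^ m))ˣ, Ω.image (fun x => (u : ZMod (p ^ m)) • x) = Ω)
    (y : ι → ZMod (p ^ m)) :
    (Fintype.card (ZMod (p ^ m))ˣ : ℂ) * ∑ ω ∈ Ω, χ (y ⬝ᵥ ω) =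
      Fintype.card (ZMod (p ^ m))ˣ * Ω.card - p * (∑ ω ∈ Ω, hwt p m (y ⬝ᵥ ω) : ℕ) := by
  have hmul (u : (ZMod (p ^ m))ˣ) : ∑ ω ∈ Ω, χ (u * (y ⬝ᵥ ω)) = ∑ ω ∈ Ω, χ (y ⬝ᵥ ω) := by
    conv_rhs => rw [← hunit u]
    rw [Finset.sum_image fun a _ b _ hab => u.isUnit.smul_left_cancel.mp hab]
    simp [dotProduct_smul]
  calc (Fintype.card (ZMod (p ^ m))ˣ : ℂ) * ∑ ω ∈ Ω, χ (y ⬝ᵥ ω)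
      = ∑ u : (ZMod (p ^ m))ˣ, ∑ ω ∈ Ω, χ (u * (y ⬝ᵥ ω)) := by simp [hmul]
    _ = _ := by
      rw [Finset.sum_comm]
      simp_rw [sum_units_addChar_eq_sub_hwt hm hχ]
      rw [Finset.sum_sub_distrib, Finset.sum_const, nsmul_eq_mul, ← Finset.mul_sum]
      push_cast
      ring

theorem stmt4 (p m : ℕ) [Fact p.Prime] (hm : 2 ≤ m)
    {k : ℕ} (hk : 1 ≤ k) (Ω : Finset (Fin k → ZMod (p^m)))
    (h0 : (0 : Fin k → ZMod (p^m)) ∉ Ω)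
    (hunit : ∀ u : (ZMod (p^m))ˣ, Ω.image (fun x => (u : ZMod (p^m)) • x) = Ω)
    (hreg : ∀ ω ∈ Ω, ∃ i, IsUnit (ω i))
    (hspan : Submodule.span (ZMod (p^m)) (Ω : Set (Fin k → ZMod (p^m))) = ⊤)
    (n : ℕ) (hn : Ω.card = n * (p - 1) * p^(m-1))
    (w1 w2 w3 : ℕ) (hw1 : 0 < w1) (h12 : w1 < w2) (h23 : w2 < w3)
    -- three-weight hypothesis: the homogeneous weight `W x` of the dual codeword
    -- determined by a nonzero `x`, i.e. `(∑ ω ∈ Ω, hwt (x·ω)) / ((p-1)p^(m-1))`,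
    -- takes exactly the values `w1, w2, w3`
    (hW : (fun x : Fin k → ZMod (p^m) => ∑ ω ∈ Ω, hwt p m (∑ i, x i * ω i)) ''
            {x | x ≠ 0}
          = {w1 * ((p - 1) * p^(m-1)), w2 * ((p - 1) * p^(m-1)),
             w3 * ((p - 1) * p^(m-1))})
    (hw2 : w2 = n * (p - 1) * p^(m-2))
    (hw13 : w1 + w3 = 2 * n * (p - 1) * p^(m-2)) :
    ∀ s : ℕ, Odd s → 1 < s → IsSumSet Ω s := by
  have hp : p.Prime := Fact.out
  intro s hs _
  have hχ := ZMod.isPrimitive_stdAddChar (p ^ m)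
  have hcardu : Fintype.card (ZMod (p ^ m))ˣ = (p - 1) * p ^ (m - 1) := by
    rw [ZMod.card_units_eq_totient, Nat.totient_prime_pow hp (by omega), mul_comm]
  have hpm : p ^ (m - 1) = p * p ^ (m - 2) := by rw [← pow_succ']; congr 1; omega
  have hΩ2 : p * w2 = Ω.card := by rw [hw2, hn, hpm]; ring
  have hΩ13 : p * w1 + p * w3 = 2 * Ω.card := by rw [← mul_add, hw13, hn, hpm]; ring
  have hΩ2' : (p * w2 : ℂ) = Ω.card := by exact_mod_cast hΩ2
  have hΩ13' : (p * w1 + p * w3 : ℂ) = 2 * Ω.card := by exact_mod_cast hΩ13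
  have hφ : (Fintype.card (ZMod (p ^ m))ˣ : ℂ) ≠ 0 := Nat.cast_ne_zero.mpr Fintype.card_ne_zero
  have hval (y : Fin k → ZMod (p ^ m)) (w : ℕ)
      (hy : ∑ ω ∈ Ω, hwt p m (∑ i, y i * ω i) = w * ((p - 1) * p ^ (m - 1))) :
      ∑ ω ∈ Ω, ZMod.stdAddChar (y ⬝ᵥ ω) = (Ω.card - p * w : ℂ) := by
    refine mul_left_cancel₀ hφ ?_
    rw [card_units_mul_sum_addChar hm hχ Ω hunit y]
    simp only [dotProduct]
    rw [hy, ← hcardu]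
    push_cast
    ring
  obtain ⟨j, rfl⟩ := hs
  refine isSumSet_of_pow_eq_mul hχ Ω _ (((Ω.card : ℂ) - p * w1) ^ (2 * j)) fun y hy => ?_
  have hmem := hW.subset (Set.mem_image_of_mem _ hy)
  simp only [Set.mem_insert_iff, Set.mem_singleton_iff] at hmem
  rcases hmem with h | h | h
  · rw [hval y w1 h, pow_succ]
  · rw [hval y w2 h, hΩ2', sub_self, mul_zero, zero_pow (by omega)]
  · have h3 : (Ω.card - p * w3 : ℂ) = -(Ω.card - p * w1) := by linear_combination -hΩ13'
    rw [hval y w3 h, h3, pow_succ, Even.neg_pow (even_two_mul j)]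
end

section
/- Under the three-weight hypothesis on Ω ⊆ ZMod(p^m)^k: if w2 ≠ n·(p−1)·p^(m−2) or w1 + w3 ≠ 2·n·(p−1)·p^(m−2), then there is at most one integer s > 1 such that Ω is an s-sum set; that is, if Ω is both an s-sum set and an s'-sum set with s, s' > 1, then s = s'. -/
theorem StrictConvexOn.not_three_points_on_line {D : Set ℝ} {f : ℝ → ℝ} (hf : StrictConvexOn ℝ D f)
    {x y z α β : ℝ} (hx : x ∈ D) (hz : z ∈ D) (hxy : x < y) (hyz : y < z)
    (fx : f x = α * x + β) (fy : f y = α * y + β) (fz : f z = α * z + β) : False := by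
  have h := hf.slope_strict_mono_adjacent hx hz hxy hyz
  have e1 : (f y - f x) / (y - x) = α := by
    rw [fx, fy, div_eq_iff (sub_ne_zero.2 hxy.ne')]; ring
  have e2 : (f z - f y) / (z - y) = α := by
    rw [fy, fz, div_eq_iff (sub_ne_zero.2 hyz.ne')]; ring
  rw [e1, e2] at h
  exact lt_irrefl _ h

/-- Strict convexity of `t ↦ u ^ t`, sampled at `1 < s < t`. -/
theorem sub_one_mul_pow_lt {u : ℝ} (hu : 0 < u) (hu1 : u ≠ 1) {s t : ℕ} (hs : 1 < s) (hst : s < t) :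
    ((t : ℝ) - 1) * u ^ s < ((t : ℝ) - s) * u + ((s : ℝ) - 1) * u ^ t := by
  have hs' : (1 : ℝ) < s := by exact_mod_cast hs
  have hst' : (s : ℝ) < t := by exact_mod_cast hst
  have ht : (0 : ℝ) < t - 1 := by linarith
  have hlog : Real.log u ≠ 0 := Real.log_ne_zero_of_pos_of_ne_one hu hu1
  have hne : Real.log u ≠ t * Real.log u := by
    intro h
    have : ((t : ℝ) - 1) * Real.log u = 0 := by linarith
    rcases mul_eq_zero.1 this with h | h
    · linarith
    · exact hlog h
  have h := strictConvexOn_exp.2 (Set.mem_univ (Real.log u)) (Set.mem_univ (t * Real.log u)) hne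
    (div_pos (sub_pos.2 hst') ht) (div_pos (sub_pos.2 hs') ht)
    (by rw [← add_div, div_eq_one_iff_eq ht.ne']; ring)
  have hexp (j : ℕ) : Real.exp (j * Real.log u) = u ^ j := by
    rw [Real.exp_nat_mul, Real.exp_log hu]
  have he : ((t : ℝ) - s) / (t - 1) * Real.log u + (s - 1) / (t - 1) * (t * Real.log u)
      = s * Real.log u := by field_simp; ring
  simp only [smul_eq_mul] at h
  rw [he, hexp, hexp, Real.exp_log hu] at h
  have h2 := mul_lt_mul_of_pos_left h ht
  calc _ < _ := h2
    _ = _ := by field_simp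

theorem eq_of_pow_relation {a b c : ℝ} (hb : 0 < b) (hba : b < a) (hc : 0 < c) {s t : ℕ}
    (hs : 1 < s) (hst : s < t)
    (es : (b + c) * a ^ s = (a + c) * b ^ s + (a - b) * c ^ s)
    (et : (b + c) * a ^ t = (a + c) * b ^ t + (a - b) * c ^ t) : False := by
  have ha : 0 < a := hb.trans hba
  have scale {j : ℕ} (e : (b + c) * a ^ j = (a + c) * b ^ j + (a - b) * c ^ j) :
      (a + c) * (b / a) ^ j + (a - b) * (c / a) ^ j = b + c := by
    have : a ^ j ≠ 0 := (pow_pos ha j).ne'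
    rw [div_pow, div_pow]
    field_simp
    linarith
  have e1 := scale (j := 1) (by ring)
  have e2 := scale es
  have e3 := scale et
  have hu := sub_one_mul_pow_lt (div_pos hb ha) ((div_lt_one ha).2 hba).ne hs hst
  have hv : ((t : ℝ) - 1) * (c / a) ^ s ≤ ((t : ℝ) - s) * (c / a) + ((s : ℝ) - 1) * (c / a) ^ t := by
    by_cases h : c / a = 1
    · rw [h]; simp
    · exact (sub_one_mul_pow_lt (div_pos hc ha) h hs hst).le
  have h1 := mul_lt_mul_of_pos_left hu (by linarith : 0 < a + c)
  have h2 := mul_le_mul_of_nonneg_left hv (by linarith : 0 ≤ a - b)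
  rw [pow_one, pow_one] at e1
  have key : ((t : ℝ) - 1) * (b + c) < ((t : ℝ) - s) * (b + c) + ((s : ℝ) - 1) * (b + c) := by
    calc ((t : ℝ) - 1) * (b + c)
        = (a + c) * (((t : ℝ) - 1) * (b / a) ^ s) + (a - b) * (((t : ℝ) - 1) * (c / a) ^ s) := by
          rw [← e2]; ring
      _ < _ := add_lt_add_of_lt_of_le h1 h2
      _ = ((t : ℝ) - s) * ((a + c) * (b / a) + (a - b) * (c / a))
          + ((s : ℝ) - 1) * ((a + c) * (b / a) ^ t + (a - b) * (c / a) ^ t) := by ring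
      _ = _ := by rw [e1, e3]
  linarith

/-- If a line meets the graph of `x ↦ x ^ s` in three points, then `s` is odd and the points lie
on both sides of the origin. -/
theorem odd_and_signs_of_three_points {x y z α β : ℝ} (hxy : x < y) (hyz : y < z) {s : ℕ}
    (hs : 1 < s) (ex : x ^ s = α * x + β) (ey : y ^ s = α * y + β) (ez : z ^ s = α * z + β) :
    Odd s ∧ x < 0 ∧ 0 < z := by
  have hodd : Odd s := by
    by_contra h
    rw [Nat.not_odd_iff_even] at h
    exact (h.strictConvexOn_pow (by omega)).not_three_points_on_line (Set.mem_univ _)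
      (Set.mem_univ _) hxy hyz ex ey ez
  refine ⟨hodd, ?_, ?_⟩
  · by_contra! h
    exact (strictConvexOn_pow hs).not_three_points_on_line (Set.mem_Ici.2 h)
      (Set.mem_Ici.2 (by linarith)) hxy hyz ex ey ez
  · by_contra! h
    refine (strictConvexOn_pow hs).not_three_points_on_line (x := -z) (y := -y) (z := -x)
      (α := α) (β := -β) (Set.mem_Ici.2 (by linarith))
      (Set.mem_Ici.2 (by linarith)) (by linarith) (by linarith) ?_ ?_ ?_
    all_goals simp only [hodd.neg_pow]; linarith

/-- Two distinct powers of three distinct reals can both be collinear with the reals themselves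
only in the symmetric configuration `-z, 0, z`. -/
theorem symmetric_of_two_pow_relations {x y z α β α' β' : ℝ} (hxy : x < y) (hyz : y < z) {s t : ℕ}
    (hs : 1 < s) (hst : s < t)
    (ex : x ^ s = α * x + β) (ey : y ^ s = α * y + β) (ez : z ^ s = α * z + β)
    (ex' : x ^ t = α' * x + β') (ey' : y ^ t = α' * y + β') (ez' : z ^ t = α' * z + β') :
    y = 0 ∧ x + z = 0 := by
  obtain ⟨os, hx, hz⟩ := odd_and_signs_of_three_points hxy hyz hs ex ey ez
  obtain ⟨ot, -, -⟩ := odd_and_signs_of_three_points hxy hyz (hs.trans hst) ex' ey' ez'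
  rcases lt_trichotomy y 0 with hy | hy | hy
  · refine (eq_of_pow_relation (a := -x) (b := -y) (c := z) (by linarith) (by linarith) hz
      hs hst ?_ ?_).elim
    · rw [os.neg_pow, os.neg_pow, ex, ey, ez]; ring
    · rw [ot.neg_pow, ot.neg_pow, ex', ey', ez']; ring
  · refine ⟨hy, ?_⟩
    subst hy
    have hβ : β = 0 := by
      rw [zero_pow (by omega)] at ey; linarith
    subst hβ
    obtain ⟨j, rfl⟩ : ∃ j, s = j + 1 := ⟨s - 1, by omega⟩
    have e1 : x ^ j = α := by
      have : x * (x ^ j - α) = 0 := by linear_combination ex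
      rcases mul_eq_zero.1 this with h | h <;> linarith
    have e2 : z ^ j = α := by
      have : z * (z ^ j - α) = 0 := by linear_combination ez
      rcases mul_eq_zero.1 this with h | h <;> linarith
    have hj : Even j := by
      rw [Nat.odd_add_one, Nat.not_odd_iff_even] at os; exact os
    have e3 : (-x) ^ j = z ^ j := by rw [hj.neg_pow, e1, e2]
    have := (pow_left_inj₀ (by linarith) hz.le (by omega)).1 e3
    linarith
  · refine (eq_of_pow_relation (a := z) (b := y) (c := -x) hy hyz (by linarith)
      hs hst ?_ ?_).elim
    · rw [os.neg_pow, ex, ey, ez]; ring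
    · rw [ot.neg_pow, ex', ey', ez']; ring

section Fourier

open Finset

variable {k N : ℕ} [NeZero N]

/-- The character sum of `Ω` at the frequency `x`. -/
noncomputable def charSum (Ω : Finset (Fin k → ZMod N)) (x : Fin k → ZMod N) : ℂ :=
  ∑ ω ∈ Ω, ZMod.stdAddChar (∑ i, x i * ω i)

theorem exists_stdAddChar_mul_ne_one {a : ZMod N} (ha : a ≠ 0) :
    ∃ z : ZMod N, ZMod.stdAddChar (z * a) ≠ 1 := by
  obtain ⟨z, hz⟩ := AddChar.ne_one_iff.1 (ZMod.isPrimitive_stdAddChar N ha)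
  exact ⟨z, by rwa [AddChar.mulShift_apply, mul_comm] at hz⟩

theorem charSum_univ {x : Fin k → ZMod N} (hx : x ≠ 0) : charSum univ x = 0 := by
  obtain ⟨i, hi⟩ := Function.ne_iff.1 hx
  obtain ⟨z, hz⟩ := exists_stdAddChar_mul_ne_one hi
  have h : ZMod.stdAddChar (z * x i) * charSum univ x = charSum univ x := by
    unfold charSum
    rw [mul_sum]
    refine Fintype.sum_equiv (Equiv.addLeft (Pi.single i z)) _ _ fun ω => ?_
    rw [← AddChar.map_add_eq_mul]
    congr 1
    simp [mul_add, sum_add_distrib, Pi.single_apply, mul_comm]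
  have h' : (ZMod.stdAddChar (z * x i) - 1) * charSum univ x = 0 := by linear_combination h
  exact (mul_eq_zero.1 h').resolve_left (sub_ne_zero.2 hz)

theorem map_sum_eq_prod_stdAddChar {ι : Type*} (S : Finset ι) (f : ι → ZMod N) :
    ZMod.stdAddChar (∑ i ∈ S, f i) = ∏ i ∈ S, ZMod.stdAddChar (f i) := by
  classical
  induction S using Finset.induction_on with
  | empty => simp
  | insert a S ha ih => rw [sum_insert ha, prod_insert ha, AddChar.map_add_eq_mul, ih]

theorem charSum_pow (Ω : Finset (Fin k → ZMod N)) (x : Fin k → ZMod N) (s : ℕ) :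
    charSum Ω x ^ s = ∑ h : Fin k → ZMod N,
      ({y : Fin s → Fin k → ZMod N | (∀ i, y i ∈ Ω) ∧ ∑ i, y i = h}.ncard : ℂ) *
        ZMod.stdAddChar (∑ i, x i * h i) := by
  have h1 : charSum Ω x ^ s = ∑ y ∈ Fintype.piFinset (fun _ : Fin s => Ω),
      ZMod.stdAddChar (∑ i, x i * (∑ j, y j) i) := by
    have := prod_univ_sum (fun _ : Fin s => Ω)
      (fun _ ω => (ZMod.stdAddChar (∑ i, x i * ω i) : ℂ))
    rw [prod_const, card_univ, Fintype.card_fin] at this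
    rw [charSum, this]
    refine sum_congr rfl fun y _ => ?_
    rw [← map_sum_eq_prod_stdAddChar]
    congr 1
    simp only [Finset.sum_apply, mul_sum]
    exact sum_comm
  rw [h1, ← sum_fiberwise _ (fun y => ∑ j, y j)]
  refine sum_congr rfl fun h _ => ?_
  have hset : {y : Fin s → Fin k → ZMod N | (∀ i, y i ∈ Ω) ∧ ∑ i, y i = h} =
      ↑{y ∈ Fintype.piFinset (fun _ : Fin s => Ω) | ∑ j, y j = h} := by
    ext y; simp
  rw [hset, Set.ncard_coe_finset, ← nsmul_eq_mul, ← sum_const]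
  refine sum_congr rfl fun y hy => ?_
  rw [(mem_filter.1 hy).2]

theorem IsSumSet.charSum_pow_eq {Ω : Finset (Fin k → ZMod N)} (h0 : (0 : Fin k → ZMod N) ∉ Ω)
    {s : ℕ} (hΩ : IsSumSet Ω s) :
    ∃ α β : ℝ, ∀ x : Fin k → ZMod N, x ≠ 0 → charSum Ω x ^ s = α * charSum Ω x + β := by
  obtain ⟨σ0, σ1, hσ⟩ := hΩ
  let c : (Fin k → ZMod N) → ℕ := fun h =>
    {y : Fin s → Fin k → ZMod N | (∀ i, y i ∈ Ω) ∧ ∑ i, y i = h}.ncard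
  have hc (h : Fin k → ZMod N) (hh : h ≠ 0) : c h = if h ∈ Ω then σ0 else σ1 := hσ h hh
  obtain ⟨d, hd⟩ : ∃ d, c 0 = d := ⟨_, rfl⟩
  refine ⟨σ0 - σ1, d - σ1, fun x hx => ?_⟩
  have hcoeff (h : Fin k → ZMod N) : (c h : ℂ) =
      σ1 + (if h ∈ Ω then (σ0 - σ1 : ℂ) else 0) + (if h = 0 then (d - σ1 : ℂ) else 0) := by
    by_cases hh : h = 0
    · subst hh; simp [h0, hd]
    · rw [hc h hh, if_neg hh]
      split_ifs <;> simp
  have h1 := charSum_univ hx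
  rw [charSum_pow]
  change ∑ h, (c h : ℂ) * _ = _
  simp only [hcoeff, add_mul, sum_add_distrib, ite_mul, zero_mul, sum_ite_mem, univ_inter,
    ← mul_sum, sum_ite_eq', mem_univ, if_true]
  unfold charSum at h1 ⊢
  rw [h1]
  simp

end Fourier

section Weight

open Finset

variable {p m : ℕ}

theorem isUnit_zmod_pow_iff [Fact p.Prime] (hm : 2 ≤ m) (y : ZMod (p ^ m)) :
    IsUnit y ↔ ¬ (p : ZMod (p ^ m)) ∣ y := by
  have hp : p.Prime := Fact.out
  have : NeZero (p ^ m) := ⟨pow_ne_zero _ hp.ne_zero⟩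
  obtain ⟨y, rfl⟩ := ZMod.natCast_zmod_surjective y
  rw [ZMod.isUnit_iff_coprime, Nat.coprime_pow_right_iff (by omega), Nat.coprime_comm,
    hp.coprime_iff_not_dvd, not_iff_not]
  refine ⟨fun h => Nat.cast_dvd_cast h, ?_⟩
  rintro ⟨z, hz⟩
  have hd : p ∣ p ^ m := dvd_pow_self p (by omega)
  have := congrArg (ZMod.castHom hd (ZMod p)) hz
  rwa [map_mul, map_natCast, map_natCast, ZMod.natCast_self, zero_mul,
    ZMod.natCast_eq_zero_iff] at this

theorem mem_span_pow_iff [Fact p.Prime] (hm : 2 ≤ m) (x : ZMod (p ^ m)) :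
    x ∈ Ideal.span {(p : ZMod (p ^ m)) ^ (m - 1)} ↔ (p : ZMod (p ^ m)) * x = 0 := by
  have hp : p.Prime := Fact.out
  have : NeZero (p ^ m) := ⟨pow_ne_zero _ hp.ne_zero⟩
  have hpm : p ^ m = p * p ^ (m - 1) := by rw [← pow_succ']; congr 1; omega
  rw [Ideal.mem_span_singleton]
  constructor
  · rintro ⟨z, rfl⟩
    rw [← mul_assoc, ← Nat.cast_pow, ← Nat.cast_mul, ← hpm, ZMod.natCast_self, zero_mul]
  · intro h
    obtain ⟨x, rfl⟩ := ZMod.natCast_zmod_surjective x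
    rw [← Nat.cast_mul, ZMod.natCast_eq_zero_iff, hpm] at h
    rw [← Nat.cast_pow]
    exact Nat.cast_dvd_cast (Nat.dvd_of_mul_dvd_mul_left hp.pos h)

theorem sum_nonunits_stdAddChar_s5 [NeZero (p ^ m)] (x : ZMod (p ^ m)) :
    ∑ y : ZMod (p ^ m) with (p : ZMod (p ^ m)) ∣ y, (ZMod.stdAddChar (y * x) : ℂ) =
      if (p : ZMod (p ^ m)) * x = 0 then
        (#{y : ZMod (p ^ m) | (p : ZMod (p ^ m)) ∣ y} : ℂ) else 0 := by
  split_ifs with h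
  · rw [card_eq_sum_ones, Nat.cast_sum]
    refine sum_congr rfl fun y hy => ?_
    obtain ⟨z, rfl⟩ := (mem_filter.1 hy).2
    rw [mul_right_comm, h, zero_mul, AddChar.map_zero_eq_one, Nat.cast_one]
  · obtain ⟨z, hz⟩ := exists_stdAddChar_mul_ne_one h
    set S := ∑ y : ZMod (p ^ m) with (p : ZMod (p ^ m)) ∣ y, (ZMod.stdAddChar (y * x) : ℂ)
    have hS : ZMod.stdAddChar (z * ((p : ZMod (p ^ m)) * x)) * S = S := by
      rw [mul_sum]
      refine sum_equiv (Equiv.addLeft (z * p)) (fun y => ?_) fun y _ => ?_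
      · simp [dvd_add_right]
      · rw [← AddChar.map_add_eq_mul]
        congr 1
        simp only [Equiv.coe_addLeft]
        ring
    have h' : (ZMod.stdAddChar (z * ((p : ZMod (p ^ m)) * x)) - 1) * S = 0 := by linear_combination hS
    exact (mul_eq_zero.1 h').resolve_left (sub_ne_zero.2 hz)

theorem sum_units_eq [NeZero (p ^ m)] (g : ZMod (p ^ m) → ℂ) :
    ∑ u : (ZMod (p ^ m))ˣ, g u = ∑ y with IsUnit y, g y := by
  classical
  refine sum_bij (fun u _ => (u : ZMod (p ^ m))) (by simp) (fun _ _ _ _ h => Units.ext h)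
    (fun y hy => ?_) fun _ _ => rfl
  obtain ⟨u, rfl⟩ := (mem_filter.1 hy).2
  exact ⟨u, mem_univ _, rfl⟩

/-- The homogeneous weight as an average of a character over the units. -/
theorem mul_hwt [Fact p.Prime] [NeZero (p ^ m)] (hm : 2 ≤ m) (x : ZMod (p ^ m)) :
    (p : ℂ) * hwt p m x = (p - 1) * p ^ (m - 1) -
      ∑ u : (ZMod (p ^ m))ˣ, (ZMod.stdAddChar ((u : ZMod (p ^ m)) * x) : ℂ) := by
  classical
  have hp : p.Prime := Fact.out
  obtain ⟨j, rfl⟩ : ∃ j, m = j + 2 := ⟨m - 2, by omega⟩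
  have split (g : ZMod (p ^ (j + 2)) → ℂ) : ∑ u : (ZMod (p ^ (j + 2)))ˣ, g u =
      ∑ y, g y - ∑ y with (p : ZMod (p ^ (j + 2))) ∣ y, g y := by
    rw [sum_units_eq, ← sum_filter_add_sum_filter_not univ
      (fun y : ZMod (p ^ (j + 2)) => (p : ZMod (p ^ (j + 2))) ∣ y)]
    simp only [isUnit_zmod_pow_iff hm]
    ring
  have hcard : (#{y : ZMod (p ^ (j + 2)) | (p : ZMod (p ^ (j + 2))) ∣ y} : ℂ) = p ^ (j + 1) := by
    have h := split fun _ => 1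
    simp only [sum_const, card_univ, ZMod.card_units_eq_totient, nsmul_eq_mul, mul_one,
      ZMod.card, Nat.totient_prime_pow hp (show 0 < j + 2 by omega)] at h
    push_cast [hp.one_le] at h
    linear_combination h
  rw [split fun y => ZMod.stdAddChar (y * x), AddChar.sum_mulShift x (ZMod.isPrimitive_stdAddChar _),
    sum_nonunits_stdAddChar_s5, hcard, hwt, mem_span_pow_iff hm, ZMod.card]
  by_cases hx : x = 0
  · subst hx
    simp
    ring
  · by_cases hpx : (p : ZMod (p ^ (j + 2))) * x = 0
    · simp [hx, hpx]
      ring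
    · simp [hx, hpx, hp.one_le]
      ring

theorem mul_sum_hwt [Fact p.Prime] [NeZero (p ^ m)] (hm : 2 ≤ m) {k : ℕ} (Ω : Finset (Fin k → ZMod (p ^ m)))
    (hunit : ∀ u : (ZMod (p ^ m))ˣ, Ω.image (fun x => (u : ZMod (p ^ m)) • x) = Ω)
    (x : Fin k → ZMod (p ^ m)) :
    (p : ℂ) * (∑ ω ∈ Ω, hwt p m (∑ i, x i * ω i) : ℕ) =
      (p - 1) * p ^ (m - 1) * (#Ω - charSum Ω x) := by
  have hp : p.Prime := Fact.out
  have hinv (u : (ZMod (p ^ m))ˣ) :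
      ∑ ω ∈ Ω, (ZMod.stdAddChar ((u : ZMod (p ^ m)) * ∑ i, x i * ω i) : ℂ) = charSum Ω x := by
    rw [charSum]
    conv_rhs => rw [← hunit u]
    rw [sum_image (g := fun ω => (u : ZMod (p ^ m)) • ω) fun a _ b _ h => smul_left_cancel u h]
    refine sum_congr rfl fun ω _ => ?_
    simp only [mul_sum, Pi.smul_apply, smul_eq_mul, mul_left_comm]
  have htot : (Fintype.card (ZMod (p ^ m))ˣ : ℂ) = (p - 1) * p ^ (m - 1) := by
    rw [ZMod.card_units_eq_totient, Nat.totient_prime_pow hp (by omega)]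
    push_cast [hp.one_le]
    ring
  push_cast
  simp only [mul_sum, mul_hwt hm, sum_sub_distrib]
  rw [sum_comm]
  simp only [← mul_sum, hinv, sum_const, nsmul_eq_mul, card_univ, htot]
  ring

end Weight

theorem stmt5 (p m : ℕ) [Fact p.Prime] (hm : 2 ≤ m)
    {k : ℕ} (hk : 1 ≤ k) (Ω : Finset (Fin k → ZMod (p^m)))
    (h0 : (0 : Fin k → ZMod (p^m)) ∉ Ω)
    (hunit : ∀ u : (ZMod (p^m))ˣ, Ω.image (fun x => (u : ZMod (p^m)) • x) = Ω)
    (hreg : ∀ ω ∈ Ω, ∃ i, IsUnit (ω i))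
    (hspan : Submodule.span (ZMod (p^m)) (Ω : Set (Fin k → ZMod (p^m))) = ⊤)
    (n : ℕ) (hn : Ω.card = n * (p - 1) * p^(m-1))
    (w1 w2 w3 : ℕ) (hw1 : 0 < w1) (h12 : w1 < w2) (h23 : w2 < w3)
    -- three-weight hypothesis: the homogeneous weight `W x` of the dual codeword
    -- determined by a nonzero `x`, i.e. `(∑ ω ∈ Ω, hwt (x·ω)) / ((p-1)p^(m-1))`,
    -- takes exactly the values `w1, w2, w3`
    (hW : (fun x : Fin k → ZMod (p^m) => ∑ ω ∈ Ω, hwt p m (∑ i, x i * ω i)) ''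
            {x | x ≠ 0}
          = {w1 * ((p - 1) * p^(m-1)), w2 * ((p - 1) * p^(m-1)),
             w3 * ((p - 1) * p^(m-1))})
    (hne : w2 ≠ n * (p - 1) * p^(m-2) ∨ w1 + w3 ≠ 2 * n * (p - 1) * p^(m-2)) :
    ∀ s s' : ℕ, 1 < s → 1 < s' → IsSumSet Ω s → IsSumSet Ω s' → s = s' := by
  have hp : p.Prime := Fact.out
  have : NeZero (p ^ m) := ⟨pow_ne_zero _ hp.ne_zero⟩
  have hp0 : (0 : ℝ) < p := by exact_mod_cast hp.pos
  have hφ : ((p : ℂ) - 1) * p ^ (m - 1) ≠ 0 := by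
    have h1 : (p : ℂ) ≠ 1 := by exact_mod_cast hp.one_lt.ne'
    have h2 : (p : ℂ) ≠ 0 := by exact_mod_cast hp.ne_zero
    exact mul_ne_zero (sub_ne_zero.2 h1) (pow_ne_zero _ h2)
  set B : ℕ := n * (p - 1) * p ^ (m - 2) with hB
  have hcard : Ω.card = p * B := by
    obtain ⟨j, rfl⟩ : ∃ j, m = j + 2 := ⟨m - 2, by omega⟩
    rw [hn, hB, show j + 2 - 1 = j + 1 by omega, Nat.add_sub_cancel, pow_succ]
    ring
  have hfreq {w : ℕ} (hw : w * ((p - 1) * p ^ (m - 1)) ∈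
      (fun x : Fin k → ZMod (p ^ m) => ∑ ω ∈ Ω, hwt p m (∑ i, x i * ω i)) '' {x | x ≠ 0}) :
      ∃ x : Fin k → ZMod (p ^ m), x ≠ 0 ∧ charSum Ω x = ((p * (B - w) : ℝ) : ℂ) := by
    obtain ⟨x, hx, hxw⟩ := hw
    refine ⟨x, hx, mul_left_cancel₀ hφ ?_⟩
    have h := mul_sum_hwt hm Ω hunit x
    simp only at hxw
    rw [hxw, hcard] at h
    push_cast [hp.one_le] at h ⊢
    linear_combination h
  obtain ⟨x1, hx1, f1⟩ := hfreq (w := w1) (by rw [hW]; simp)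
  obtain ⟨x2, hx2, f2⟩ := hfreq (w := w2) (by rw [hW]; simp)
  obtain ⟨x3, hx3, f3⟩ := hfreq (w := w3) (by rw [hW]; simp)
  have hrel {s : ℕ} (hs : IsSumSet Ω s) : ∃ α β : ℝ,
      (p * (B - w3) : ℝ) ^ s = α * (p * (B - w3)) + β ∧
      (p * (B - w2) : ℝ) ^ s = α * (p * (B - w2)) + β ∧
      (p * (B - w1) : ℝ) ^ s = α * (p * (B - w1)) + β := by
    obtain ⟨α, β, h⟩ := hs.charSum_pow_eq h0
    have h1 := h x1 hx1
    have h2 := h x2 hx2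
    have h3 := h x3 hx3
    rw [f1] at h1
    rw [f2] at h2
    rw [f3] at h3
    exact ⟨α, β, by exact_mod_cast h3, by exact_mod_cast h2, by exact_mod_cast h1⟩
  have h12' : (w1 : ℝ) < w2 := by exact_mod_cast h12
  have h23' : (w2 : ℝ) < w3 := by exact_mod_cast h23
  have main {s t : ℕ} (hs : 1 < s) (hst : s < t) (Hs : IsSumSet Ω s) (Ht : IsSumSet Ω t) :
      False := by
    obtain ⟨α, β, e3, e2, e1⟩ := hrel Hs
    obtain ⟨α', β', e3', e2', e1'⟩ := hrel Ht
    obtain ⟨h2, h13⟩ := symmetric_of_two_pow_relations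
      (mul_lt_mul_of_pos_left (by linarith) hp0) (mul_lt_mul_of_pos_left (by linarith) hp0)
      hs hst e3 e2 e1 e3' e2' e1'
    rcases hne with hne | hne
    · apply hne
      have := (mul_eq_zero.1 h2).resolve_left hp0.ne'
      exact_mod_cast (sub_eq_zero.1 this).symm
    · apply hne
      rw [← mul_add] at h13
      have := (mul_eq_zero.1 h13).resolve_left hp0.ne'
      have h : (w1 + w3 : ℝ) = 2 * B := by linarith
      have h' : w1 + w3 = 2 * B := by exact_mod_cast h
      rw [h', hB]
      ring
  intro s s' hs hs' Hs Hs'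
  rcases lt_trichotomy s s' with h | h | h
  · exact (main hs h Hs Hs').elim
  · exact h
  · exact (main hs' h Hs' Hs).elim
end

section
/- Let p be a prime, m ≥ 2, and let C ⊆ ZMod(p^m)^n be a submodule such that every nonzero vector of the dual code C⊥ has homogeneous weight at least (2p−1)·p^(m−2) (C is regular and projective). Let Γ be the syndrome/coset graph of C⊥: its vertex set is the quotient module V = ZMod(p^m)^n / C⊥, and two classes x, y are adjacent iff x − y is the class of u·e_i for some unit u of ZMod(p^m) and some standard basis vector e_i. Then the characteristic polynomial over ℝ of the adjacency matrix of Γ equals ∏_{c ∈ C} (X − (n·(p−1)·p^(m−1) − p·w(c))); equivalently, the eigenvalues of Γ are the numbers n(p−1)p^(m−1) − p·w_i, where w_i runs over the homogeneous weights of codewords of C, each with multiplicity A_i = #{c ∈ C : w(c) = w_i}. -/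
/-- The homogeneous weight of a vector, extended coordinatewise. -/
noncomputable def hwtVec (p m : ℕ) {n : ℕ} (x : Fin n → ZMod (p^m)) : ℕ :=
  ∑ i, hwt p m (x i)

/-- The dual code of a linear code `C` over a commutative ring, with respect to the
standard inner product. -/
def dualCode {R : Type*} [CommRing R] {n : ℕ} (C : Submodule R (Fin n → R)) :
    Submodule R (Fin n → R) where
  carrier := {x | ∀ c ∈ C, ∑ i, x i * c i = 0}
  add_mem' := by
    intro a b ha hb c hc
    simp only [Set.mem_setOf_eq] at *
    simp [Pi.add_apply, add_mul, Finset.sum_add_distrib, ha c hc, hb c hc]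
  zero_mem' := by
    intro c hc
    simp
  smul_mem' := by
    intro r a ha c hc
    simp only [Set.mem_setOf_eq] at *
    simp [Pi.smul_apply, smul_eq_mul, mul_assoc, ← Finset.mul_sum, ha c hc]

-- The adjacency matrix (over `ℝ`) of the syndrome/coset graph of `C⊥` : the vertices
-- are the elements of the quotient module `(ZMod (p^m))^n / C⊥`, and two classes `x, y`
-- are adjacent iff `x - y` is the class of `u • eᵢ` for some unit `u` and some standard
-- basis vector `eᵢ`.
open Classical in
noncomputable def cosetAdj (p m n : ℕ) (C : Submodule (ZMod (p^m)) (Fin n → ZMod (p^m))) :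
    Matrix ((Fin n → ZMod (p^m)) ⧸ dualCode C) ((Fin n → ZMod (p^m)) ⧸ dualCode C) ℝ :=
  fun x y =>
    if ∃ (u : (ZMod (p^m))ˣ) (i : Fin n),
        x - y = Submodule.Quotient.mk ((u : ZMod (p^m)) • (Pi.single i 1 : Fin n → ZMod (p^m))) then 1 else 0

lemma Matrix.charpoly_eq_prod_of_mulVec_eq_smul {ι κ K : Type*} [Field K] [Fintype ι]
    [DecidableEq ι] [Fintype κ] (A : Matrix ι ι K) (v : κ → ι → K) (d : κ → K)
    (hv : LinearIndependent K v) (hcard : Fintype.card κ = Fintype.card ι)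
    (h : ∀ k, A.mulVec (v k) = d k • v k) :
    A.charpoly = ∏ k, (Polynomial.X - Polynomial.C (d k)) := by
  let e : ι ≃ κ := (Fintype.equivOfCardEq hcard).symm
  let P : Matrix ι ι K := Matrix.of fun x y => v (e y) x
  have hP : IsUnit P := by
    rw [← Matrix.linearIndependent_cols_iff_isUnit]
    exact hv.comp e e.injective
  obtain ⟨M, hM⟩ := hP
  have hAP : A * P = P * Matrix.diagonal (d ∘ e) := by
    ext x y
    rw [Matrix.mul_diagonal, mul_comm]
    exact congrFun (h (e y)) x
  have hA : A = M.val * Matrix.diagonal (d ∘ e) * (M⁻¹).val := by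
    rw [hM, ← hAP, ← hM, mul_assoc, Units.mul_inv, mul_one]
  rw [hA, Matrix.coe_units_inv, Matrix.charpoly_units_conj, Matrix.charpoly_diagonal]
  exact Fintype.prod_equiv e _ _ fun _ => rfl

section HomogeneousWeight

variable {p m : ℕ}

lemma natCast_mul_pow_pred_eq_zero (hm : m ≠ 0) :
    (p : ZMod (p ^ m)) * (p : ZMod (p ^ m)) ^ (m - 1) = 0 := by
  rw [mul_pow_sub_one hm]
  exact_mod_cast ZMod.natCast_self (p ^ m)

lemma hwt_zero : hwt p m 0 = 0 := by
  simp [hwt]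

lemma hwt_le (hm : 2 ≤ m) (a : ZMod (p ^ m)) : hwt p m a ≤ p ^ (m - 1) := by
  unfold hwt
  split_ifs
  · exact Nat.zero_le _
  · exact le_rfl
  · obtain ⟨k, rfl⟩ := Nat.exists_eq_add_of_le' hm
    simp only [Nat.add_sub_cancel, Nat.add_one_sub_one, pow_succ']
    exact Nat.mul_le_mul_right _ (Nat.sub_le _ _)

variable [Fact p.Prime]

lemma mem_span_pow_pred_iff (hm : m ≠ 0) (a : ZMod (p ^ m)) :
    a ∈ Ideal.span {(p : ZMod (p ^ m)) ^ (m - 1)} ↔ (p : ZMod (p ^ m)) * a = 0 := by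
  have hp : p.Prime := Fact.out
  rw [Ideal.mem_span_singleton]
  constructor
  · rintro ⟨b, rfl⟩
    rw [← mul_assoc, natCast_mul_pow_pred_eq_zero hm, zero_mul]
  · intro h
    obtain ⟨k, rfl⟩ := ZMod.natCast_zmod_surjective a
    have hk : p ^ m ∣ p * k := by
      rw [← ZMod.natCast_eq_zero_iff]
      exact_mod_cast h
    rw [← mul_pow_sub_one hm p] at hk
    exact_mod_cast Nat.cast_dvd_cast (α := ZMod (p ^ m)) (Nat.dvd_of_mul_dvd_mul_left hp.pos hk)

lemma hwt_unit_le (hm : 2 ≤ m) (u : (ZMod (p ^ m))ˣ) :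
    hwt p m (u : ZMod (p ^ m)) ≤ (p - 1) * p ^ (m - 2) := by
  have hp : p.Prime := Fact.out
  unfold hwt
  split_ifs with h0 h
  · exact Nat.zero_le _
  · rw [mem_span_pow_pred_iff (by omega), Units.mul_left_eq_zero, ZMod.natCast_eq_zero_iff] at h
    have := (Nat.pow_dvd_pow_iff_le_right hp.one_lt).1 (h.trans (pow_one p).symm.dvd)
    omega
  · exact le_rfl

lemma sum_units_stdAddChar_mul (hm : 2 ≤ m) (a : ZMod (p ^ m)) :
    ∑ u : (ZMod (p ^ m))ˣ, ZMod.stdAddChar ((u : ZMod (p ^ m)) * a) =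
      (((p - 1) * p ^ (m - 1) : ℕ) : ℂ) - p * hwt p m a := by
  classical
  have hp : p.Prime := Fact.out
  have hm0 : m ≠ 0 := by omega
  have hunits : ∑ u : (ZMod (p ^ m))ˣ, ZMod.stdAddChar ((u : ZMod (p ^ m)) * a) =
      ∑ x : ZMod (p ^ m) with IsUnit x, ZMod.stdAddChar (x * a) :=
    Finset.sum_bij (fun u _ => u.val) (by simp) (fun _ _ _ _ h => Units.ext h)
      (fun x hx => ⟨(Finset.mem_filter.1 hx).2.unit, by simp⟩) (fun _ _ => rfl)
  have hnonunits : ∑ x : ZMod (p ^ m) with ¬ IsUnit x, ZMod.stdAddChar (x * a) =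
      ∑ k ∈ Finset.range (p ^ (m - 1)), ZMod.stdAddChar ((p : ZMod (p ^ m)) * a) ^ k := by
    symm
    refine Finset.sum_bij (fun k _ => ((p * k : ℕ) : ZMod (p ^ m))) ?_ ?_ ?_ ?_
    · intro k _
      simp [ZMod.isUnit_iff_coprime, Nat.coprime_pow_right_iff hm0.bot_lt, hp.one_lt.ne']
    · intro k hk l hl h
      have hlt : ∀ j ∈ Finset.range (p ^ (m - 1)), p * j < p ^ m := fun j hj => by
        rw [← mul_pow_sub_one hm0 p]
        exact Nat.mul_lt_mul_of_pos_left (Finset.mem_range.1 hj) hp.pos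
      have h' := (ZMod.natCast_eq_natCast_iff' _ _ _).1 h
      rw [Nat.mod_eq_of_lt (hlt k hk), Nat.mod_eq_of_lt (hlt l hl)] at h'
      exact Nat.eq_of_mul_eq_mul_left hp.pos h'
    · intro x hx
      have hx' : ¬ IsUnit ((x.val : ℕ) : ZMod (p ^ m)) := by
        simpa using hx
      rw [ZMod.isUnit_iff_coprime, Nat.coprime_pow_right_iff hm0.bot_lt, Nat.coprime_comm,
        hp.coprime_iff_not_dvd, not_not] at hx'
      obtain ⟨k, hk⟩ := hx'
      refine ⟨k, Finset.mem_range.2 ?_, ?_⟩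
      · have := ZMod.val_lt x
        rw [hk, ← mul_pow_sub_one hm0 p] at this
        exact Nat.lt_of_mul_lt_mul_left this
      · rw [← hk, ZMod.natCast_zmod_val]
    · intro k _
      rw [← AddChar.map_nsmul_eq_pow]
      congr 1
      push_cast
      rw [nsmul_eq_mul]
      ring
  have htotal : ∑ x : ZMod (p ^ m), ZMod.stdAddChar (x * a) =
      ((if a = 0 then p ^ m else 0 : ℕ) : ℂ) := by
    rw [AddChar.sum_mulShift a (ZMod.isPrimitive_stdAddChar (p ^ m)), ZMod.card]
  rw [← Finset.sum_filter_add_sum_filter_not _ (fun x => IsUnit x), ← hunits, hnonunits] at htotal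
  rw [eq_sub_of_add_eq htotal]
  have hpow : (p : ℂ) ^ m = p * p ^ (m - 1) := (mul_pow_sub_one hm0 _).symm
  have hpow' : (p : ℂ) ^ (m - 1) = p * p ^ (m - 2) := by
    rw [← pow_succ']
    congr 1
    omega
  have hone : ZMod.stdAddChar ((p : ZMod (p ^ m)) * a) = 1 ↔ (p : ZMod (p ^ m)) * a = 0 := by
    rw [← AddChar.map_zero_eq_one (ZMod.stdAddChar (N := p ^ m)),
      (ZMod.injective_stdAddChar (N := p ^ m)).eq_iff]
  unfold hwt
  simp only [mem_span_pow_pred_iff hm0]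
  split_ifs with h0 h
  · subst h0
    simp [Nat.cast_sub hp.one_le, hpow]
    ring
  · simp [h, Nat.cast_sub hp.one_le]
    ring
  · have hgeom := geom_sum_mul (ZMod.stdAddChar ((p : ZMod (p ^ m)) * a)) (p ^ (m - 1))
    rw [← AddChar.map_nsmul_eq_pow, nsmul_eq_mul, ← mul_assoc, Nat.cast_pow,
      mul_comm ((p : ZMod (p ^ m)) ^ (m - 1)),
      natCast_mul_pow_pred_eq_zero hm0, zero_mul, AddChar.map_zero_eq_one, sub_self,
      mul_eq_zero, sub_eq_zero, hone, or_iff_left h] at hgeom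
    rw [hgeom]
    simp [Nat.cast_sub hp.one_le, hpow']
    ring

lemma eq_of_smul_single_sub_mem_dualCode (hm : 2 ≤ m) {n : ℕ}
    {C : Submodule (ZMod (p ^ m)) (Fin n → ZMod (p ^ m))}
    (hproj : ∀ x ∈ dualCode C, x ≠ 0 → (2 * p - 1) * p ^ (m - 2) ≤ hwtVec p m x)
    {u v : (ZMod (p ^ m))ˣ} {i j : Fin n}
    (h : (u : ZMod (p ^ m)) • (Pi.single i 1 : Fin n → ZMod (p ^ m)) -
      (v : ZMod (p ^ m)) • Pi.single j 1 ∈ dualCode C) :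
    u = v ∧ i = j := by
  have hp : p.Prime := Fact.out
  have : Fact (1 < p ^ m) := ⟨Nat.one_lt_pow (by omega) hp.one_lt⟩
  have hpos : 0 < p ^ (m - 2) := pow_pos hp.pos _
  have h2 := hp.two_le
  by_cases hij : i = j
  · subst hij
    refine ⟨?_, rfl⟩
    by_contra huv
    have hne : (u : ZMod (p ^ m)) - v ≠ 0 := fun h => huv (Units.ext (sub_eq_zero.1 h))
    rw [← sub_smul] at h
    have hw := hproj _ h fun h0 => hne (by simpa using congrFun h0 i)
    have hle : hwtVec p m (((u : ZMod (p ^ m)) - v) • (Pi.single i 1 : Fin n → ZMod (p ^ m))) ≤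
        p * p ^ (m - 2) := by
      unfold hwtVec
      rw [Fintype.sum_eq_single i fun k hk => by simp [hk, hwt_zero], ← pow_succ',
        show m - 2 + 1 = m - 1 by omega]
      exact hwt_le hm _
    have := Nat.le_of_mul_le_mul_right (hw.trans hle) hpos
    omega
  · exfalso
    have hw := hproj _ h fun h0 => u.ne_zero (by simpa [hij] using congrFun h0 i)
    have hle : hwtVec p m ((u : ZMod (p ^ m)) • (Pi.single i 1 : Fin n → ZMod (p ^ m)) -
        (v : ZMod (p ^ m)) • Pi.single j 1) ≤ (2 * (p - 1)) * p ^ (m - 2) := by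
      unfold hwtVec
      rw [Fintype.sum_eq_add i j hij fun k hk => by simp [hk.1, hk.2, hwt_zero]]
      have hu := hwt_unit_le hm u
      have hv := hwt_unit_le hm (-v)
      simp only [Units.val_neg] at hv
      simp only [Pi.sub_apply, Pi.smul_apply, smul_eq_mul, Pi.single_eq_same,
        Pi.single_eq_of_ne hij, Pi.single_eq_of_ne (Ne.symm hij), mul_one, mul_zero, sub_zero,
        zero_sub]
      linarith
    have := Nat.le_of_mul_le_mul_right (hw.trans hle) hpos
    omega

end HomogeneousWeight

/-- The linear functional on the quotient by the dual code given by pairing with a codeword. -/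
noncomputable def syndrome {R : Type*} [CommRing R] {n : ℕ} {C : Submodule R (Fin n → R)} (c : C) :
    ((Fin n → R) ⧸ dualCode C) →ₗ[R] R :=
  (dualCode C).liftQ (Fintype.linearCombination R (c : Fin n → R)) fun x hx => by
    simpa [Fintype.linearCombination_apply] using hx c c.2

lemma syndrome_mk {R : Type*} [CommRing R] {n : ℕ} {C : Submodule R (Fin n → R)} (c : C)
    (x : Fin n → R) : syndrome c (Submodule.Quotient.mk x) = ∑ i, x i * (c : Fin n → R) i :=
  rfl

lemma syndrome_add {R : Type*} [CommRing R] {n : ℕ} {C : Submodule R (Fin n → R)} (c d : C)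
    (x : (Fin n → R) ⧸ dualCode C) : syndrome (c + d) x = syndrome c x + syndrome d x := by
  induction x using Submodule.Quotient.induction_on
  simp [syndrome_mk, mul_add, Finset.sum_add_distrib]

section Characters

variable {N n : ℕ} [NeZero N] {C : Submodule (ZMod N) (Fin n → ZMod N)}

/-- The character of the quotient by the dual code attached to a codeword. -/
noncomputable def codewordChar (c : C) : AddChar ((Fin n → ZMod N) ⧸ dualCode C) ℂ :=
  ZMod.stdAddChar.compAddMonoidHom (syndrome c).toAddMonoidHom

lemma codewordChar_apply (c : C) (x : (Fin n → ZMod N) ⧸ dualCode C) :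
    codewordChar c x = ZMod.stdAddChar (syndrome c x) :=
  rfl

lemma codewordChar_injective : Function.Injective (codewordChar (C := C)) := by
  intro c d h
  ext i
  have := DFunLike.congr_fun h (Submodule.Quotient.mk (Pi.single i 1))
  rw [codewordChar_apply, codewordChar_apply, ZMod.injective_stdAddChar.eq_iff, syndrome_mk,
    syndrome_mk] at this
  simpa [Pi.single_apply] using this

/-- The character of the code attached to a class modulo the dual code. -/
noncomputable def syndromeChar (x : (Fin n → ZMod N) ⧸ dualCode C) : AddChar C ℂ :=
  ZMod.stdAddChar.compAddMonoidHom
    (AddMonoidHom.mk' (fun c : C => syndrome c x) fun c d => syndrome_add c d x)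

lemma syndromeChar_injective : Function.Injective (syndromeChar (C := C)) := by
  intro x y h
  have hxy : ∀ c : C, syndrome c x = syndrome c y := fun c =>
    ZMod.injective_stdAddChar (DFunLike.congr_fun h c)
  induction x using Submodule.Quotient.induction_on with | _ x =>
  induction y using Submodule.Quotient.induction_on with | _ y =>
  rw [Submodule.Quotient.eq]
  intro c hc
  have := hxy ⟨c, hc⟩
  rw [syndrome_mk, syndrome_mk] at this
  simp [sub_mul, this]

lemma card_code_eq_card_quotient_dualCode [Fintype C]
    [Fintype ((Fin n → ZMod N) ⧸ dualCode C)] :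
    Fintype.card C = Fintype.card ((Fin n → ZMod N) ⧸ dualCode C) :=
  le_antisymm
    ((Fintype.card_le_of_injective _ (codewordChar_injective (C := C))).trans_eq AddChar.card_eq)
    ((Fintype.card_le_of_injective _ (syndromeChar_injective (C := C))).trans_eq AddChar.card_eq)

end Characters

section CosetGraph

variable {p m n : ℕ} [Fact p.Prime] {C : Submodule (ZMod (p ^ m)) (Fin n → ZMod (p ^ m))}
  [Fintype ((Fin n → ZMod (p ^ m)) ⧸ dualCode C)]

lemma cosetAdj_map_mulVec (hm : 2 ≤ m)
    (hproj : ∀ x ∈ dualCode C, x ≠ 0 → (2 * p - 1) * p ^ (m - 2) ≤ hwtVec p m x)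
    (f : ((Fin n → ZMod (p ^ m)) ⧸ dualCode C) → ℂ) (x : (Fin n → ZMod (p ^ m)) ⧸ dualCode C) :
    ((cosetAdj p m n C).map Complex.ofRealHom).mulVec f x =
      ∑ i : Fin n, ∑ u : (ZMod (p ^ m))ˣ, f (x - Submodule.Quotient.mk
        ((u : ZMod (p ^ m)) • (Pi.single i 1 : Fin n → ZMod (p ^ m)))) := by
  classical
  let g : Fin n × (ZMod (p ^ m))ˣ → (Fin n → ZMod (p ^ m)) ⧸ dualCode C := fun q =>
    x - Submodule.Quotient.mk
      ((q.2 : ZMod (p ^ m)) • (Pi.single q.1 1 : Fin n → ZMod (p ^ m)))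
  have hg : Function.Injective g := fun q r h => by
    have := eq_of_smul_single_sub_mem_dualCode hm hproj
      ((Submodule.Quotient.eq _).1 (sub_right_injective h))
    exact Prod.ext this.2 this.1
  rw [← Fintype.sum_prod_type' (f := fun i u => f (g (i, u))), ← Finset.sum_image hg.injOn]
  simp only [Matrix.mulVec, dotProduct, Matrix.map_apply, cosetAdj, apply_ite, map_one, map_zero,
    ite_mul, one_mul, zero_mul]
  rw [← Finset.sum_filter]
  congr 1
  ext y
  simp only [Finset.mem_filter, Finset.mem_univ, true_and, Finset.mem_image, Prod.exists, g]
  rw [exists_comm]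
  refine exists_congr fun i => exists_congr fun u => ?_
  rw [sub_eq_iff_comm]

lemma cosetAdj_map_mulVec_codewordChar (hm : 2 ≤ m)
    (hproj : ∀ x ∈ dualCode C, x ≠ 0 → (2 * p - 1) * p ^ (m - 2) ≤ hwtVec p m x) (c : C) :
    ((cosetAdj p m n C).map Complex.ofRealHom).mulVec (codewordChar c) =
      (((n * (p - 1) * p ^ (m - 1) : ℕ) : ℂ) - p * hwtVec p m (c : Fin n → ZMod (p ^ m))) •
        ⇑(codewordChar c) := by
  ext x
  have hterm : ∀ i : Fin n, ∑ u : (ZMod (p ^ m))ˣ, codewordChar c (x - Submodule.Quotient.mk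
        ((u : ZMod (p ^ m)) • (Pi.single i 1 : Fin n → ZMod (p ^ m)))) =
      codewordChar c x * ((((p - 1) * p ^ (m - 1) : ℕ) : ℂ) -
        p * hwt p m ((c : Fin n → ZMod (p ^ m)) i)) := fun i => by
    rw [← sum_units_stdAddChar_mul hm, Finset.mul_sum, ← Equiv.sum_comp (Equiv.neg _)]
    refine Finset.sum_congr rfl fun u _ => ?_
    rw [Equiv.neg_apply, Units.val_neg, neg_smul, Submodule.Quotient.mk_neg, sub_neg_eq_add,
      AddChar.map_add_eq_mul, codewordChar_apply c (Submodule.Quotient.mk _), syndrome_mk]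
    simp [Pi.single_apply]
  rw [cosetAdj_map_mulVec hm hproj, Finset.sum_congr rfl fun i _ => hterm i, ← Finset.mul_sum,
    Finset.sum_sub_distrib, ← Finset.mul_sum, Pi.smul_apply, smul_eq_mul, mul_comm]
  simp [hwtVec, mul_assoc]

end CosetGraph

theorem stmt6 (p m : ℕ) [Fact p.Prime] (hm : 2 ≤ m) (n : ℕ)
    (C : Submodule (ZMod (p^m)) (Fin n → ZMod (p^m)))
    [Fintype C]
    [Fintype ((Fin n → ZMod (p^m)) ⧸ dualCode C)]
    [DecidableEq ((Fin n → ZMod (p^m)) ⧸ dualCode C)]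
    -- regular and projective: every nonzero dual codeword has homogeneous weight
    -- at least (2p-1)·p^(m-2)
    (hproj : ∀ x ∈ dualCode C, x ≠ 0 → (2 * p - 1) * p^(m-2) ≤ hwtVec p m x) :
    (cosetAdj p m n C).charpoly =
      ∏ c : C, (Polynomial.X -
        Polynomial.C (((n * (p - 1) * p^(m-1) : ℕ) : ℝ) -
          (p : ℝ) * (hwtVec p m (c : Fin n → ZMod (p^m)) : ℝ))) := by
  apply Polynomial.map_injective Complex.ofRealHom Complex.ofReal_injective
  rw [← Matrix.charpoly_map, Matrix.charpoly_eq_prod_of_mulVec_eq_smul _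
    (fun c : C => ⇑(codewordChar c)) _
    ((AddChar.linearIndependent _ ℂ).comp _ codewordChar_injective)
    card_code_eq_card_quotient_dualCode (cosetAdj_map_mulVec_codewordChar hm hproj),
    Polynomial.map_prod]
  simp
end

section
/- Let p be a prime and m ≥ 2. The explicitly defined function w on ZMod(p^m) is a homogeneous weight with normalization constant γ = (p−1)p^(m−2); that is: (i) w(0) = 0; (ii) for all x, y ∈ ZMod(p^m), if the principal ideals (x) and (y) are equal then w(x) = w(y); and (iii) for every x ≠ 0, ∑_{y ∈ (x)} w(y) = (p−1)·p^(m−2)·|(x)|, where (x) denotes the ideal of ZMod(p^m) generated by x. -/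
/-- Every nonzero ideal of `ZMod (p^m)` contains the ideal generated by `p^(m-1)`. -/
theorem span_prime_pow_pred_le_span (p m : ℕ) [hp : Fact p.Prime] (x : ZMod (p ^ m))
    (hx : x ≠ 0) :
    Ideal.span {(p : ZMod (p ^ m)) ^ (m - 1)} ≤ Ideal.span {x} := by
  rw [Ideal.span_singleton_le_span_singleton]
  have hne : x.val ≠ 0 := by simpa [ZMod.val_eq_zero] using hx
  obtain ⟨k, u, hu, hxu⟩ := Nat.exists_eq_pow_mul_and_not_dvd hne p hp.out.ne_one
  have hk : k < m := by
    by_contra! h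
    refine hx ?_
    rw [← ZMod.natCast_zmod_val x, ZMod.natCast_eq_zero_iff, hxu]
    exact (pow_dvd_pow p h).mul_right u
  have hunit : IsUnit (u : ZMod (p ^ m)) := by
    rw [ZMod.isUnit_iff_coprime]
    exact (((Nat.Prime.coprime_iff_not_dvd hp.out).2 hu).pow_left m).symm
  have hxeq : x = (p : ZMod (p ^ m)) ^ k * u := by
    rw [← ZMod.natCast_zmod_val x, hxu]
    push_cast
    rfl
  rw [hxeq, hunit.mul_right_dvd]
  exact pow_dvd_pow _ (by omega)

/-- The ideal of `ZMod (p^m)` generated by `p^(m-1)` has `p` elements. -/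
theorem card_span_prime_pow_pred (p m : ℕ) [hp : Fact p.Prime] (hm : m ≠ 0) :
    Nat.card (Ideal.span {(p : ZMod (p ^ m)) ^ (m - 1)}) = p := by
  have hset : ((Ideal.span {(p : ZMod (p ^ m)) ^ (m - 1)} : Ideal (ZMod (p ^ m))) :
      Set (ZMod (p ^ m))) = AddSubgroup.zmultiples ((p : ZMod (p ^ m)) ^ (m - 1)) := by
    ext y
    simp only [SetLike.mem_coe, Ideal.mem_span_singleton', AddSubgroup.mem_zmultiples_iff,
      zsmul_eq_mul]
    constructor
    · rintro ⟨a, rfl⟩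
      exact ⟨a.val, by simp⟩
    · rintro ⟨a, rfl⟩
      exact ⟨a, rfl⟩
  have hcard : Nat.card (Ideal.span {(p : ZMod (p ^ m)) ^ (m - 1)}) =
      Nat.card (AddSubgroup.zmultiples ((p : ZMod (p ^ m)) ^ (m - 1))) :=
    Nat.card_congr (Equiv.setCongr hset)
  obtain ⟨n, rfl⟩ := Nat.exists_eq_succ_of_ne_zero hm
  rw [hcard, Nat.card_zmultiples, ← Nat.cast_pow,
    ZMod.addOrderOf_coe _ (pow_ne_zero _ hp.out.ne_zero)]
  simp only [Nat.succ_eq_add_one, Nat.add_sub_cancel]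
  rw [Nat.gcd_eq_right (pow_dvd_pow p n.le_succ), pow_succ,
    Nat.mul_div_cancel_left _ (pow_pos hp.out.pos n)]

open Classical in
theorem hwt_add_ite (p m : ℕ) [hp : Fact p.Prime] (hm : 2 ≤ m) (y : ZMod (p ^ m)) :
    hwt p m y + (if y = 0 then p ^ (m - 1) else 0) = (p - 1) * p ^ (m - 2) +
      (if y ∈ Ideal.span {(p : ZMod (p ^ m)) ^ (m - 1)} then p ^ (m - 2) else 0) := by
  have hpow : p ^ (m - 1) = (p - 1) * p ^ (m - 2) + p ^ (m - 2) := by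
    rw [← Nat.succ_mul, Nat.succ_eq_add_one, Nat.sub_add_cancel hp.out.one_le, ← pow_succ']
    congr 1
    omega
  unfold hwt
  by_cases h0 : y = 0
  · subst h0
    simpa using hpow
  · by_cases hS : y ∈ Ideal.span {(p : ZMod (p ^ m)) ^ (m - 1)}
    · simpa only [h0, hS, if_true, if_false, add_zero] using hpow
    · simp only [h0, hS, if_false]

/-- The explicit function `hwt` is a homogeneous weight on `ZMod (p^m)` with
normalization constant `γ = (p-1)·p^(m-2)`. -/
theorem stmt8 (p m : ℕ) [Fact p.Prime] (hm : 2 ≤ m) :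
    hwt p m 0 = 0 ∧
    (∀ x y : ZMod (p^m),
      Ideal.span ({x} : Set (ZMod (p^m))) = Ideal.span ({y} : Set (ZMod (p^m))) →
        hwt p m x = hwt p m y) ∧
    (∀ x : ZMod (p^m), x ≠ 0 →
      ∑ᶠ y ∈ ((Ideal.span ({x} : Set (ZMod (p^m)))) : Set (ZMod (p^m))), hwt p m y
        = (p - 1) * p^(m-2) *
            ((Ideal.span ({x} : Set (ZMod (p^m)))) : Set (ZMod (p^m))).ncard) := by
  classical
  have hp : p.Prime := Fact.out
  refine ⟨by simp [hwt], fun x y hxy => ?_, fun x hx => ?_⟩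
  · have h0 : x = 0 ↔ y = 0 := by
      rw [← Ideal.span_singleton_eq_bot, hxy, Ideal.span_singleton_eq_bot]
    have hS : x ∈ Ideal.span {(p : ZMod (p^m))^(m-1)} ↔
        y ∈ Ideal.span {(p : ZMod (p^m))^(m-1)} := by
      rw [← Ideal.span_singleton_le_iff_mem, hxy, Ideal.span_singleton_le_iff_mem]
    simp only [hwt, h0, hS]
  · have hle := span_prime_pow_pred_le_span p m x hx
    have hcard := card_span_prime_pow_pred p m (by omega)
    set I := Ideal.span ({x} : Set (ZMod (p^m)))
    set S := Ideal.span {(p : ZMod (p^m))^(m-1)} with hSdef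
    have hsum : ∑ y ∈ (I : Set (ZMod (p^m))).toFinset,
        (hwt p m y + (if y = 0 then p^(m-1) else 0)) =
        ∑ y ∈ (I : Set (ZMod (p^m))).toFinset,
          ((p - 1) * p^(m-2) + (if y ∈ S then p^(m-2) else 0)) :=
      Finset.sum_congr rfl fun y _ => hwt_add_ite p m hm y
    have hfilter : (I : Set (ZMod (p^m))).toFinset.filter (· ∈ S) =
        (S : Set (ZMod (p^m))).toFinset := by
      ext y
      simpa using fun h => hle h
    have hScard : (S : Set (ZMod (p^m))).toFinset.card = p := by
      rw [← Set.ncard_eq_toFinset_card', ← Nat.card_coe_set_eq]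
      exact hcard
    have hpow : p * p^(m-2) = p^(m-1) := by
      rw [← pow_succ']
      congr 1
      omega
    rw [Finset.sum_add_distrib, Finset.sum_add_distrib, Finset.sum_ite_eq',
      if_pos (by simp), ← Finset.sum_filter, hfilter, Finset.sum_const, Finset.sum_const,
      hScard, smul_eq_mul, smul_eq_mul, hpow, ← Set.ncard_eq_toFinset_card'] at hsum
    rw [finsum_mem_eq_toFinset_sum, mul_comm]
    exact Nat.add_right_cancel hsum
end

section
/- Let Γ be a connected k-regular finite simple graph whose real adjacency matrix A has exactly four distinct eigenvalues k > θ1 > θ2 > θ3. Then Γ is a 3-strongly walk-regular graph if and only if θ1 + θ2 + θ3 = 0. -/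
/-- On a connected regular graph, eigenvectors of the adjacency matrix for the degree are constant. -/
theorem SimpleGraph.Connected.eq_of_adjMatrix_mulVec_eq_degree {V : Type*} [Fintype V]
    [DecidableEq V] {Γ : SimpleGraph V} [DecidableRel Γ.Adj] (hconn : Γ.Connected) {k : ℕ}
    (hreg : Γ.IsRegularOfDegree k) {w : V → ℝ}
    (hw : (Γ.adjMatrix ℝ).mulVec w = (k : ℝ) • w) (x y : V) : w x = w y := by
  refine (Γ.lapMatrix_mulVec_eq_zero_iff_forall_reachable (x := w)).1 ?_ x y (hconn.preconnected x y)
  ext i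
  rw [SimpleGraph.lapMatrix, Matrix.sub_mulVec, hw, SimpleGraph.degMatrix]
  simp [Matrix.mulVec_diagonal, hreg.degree_eq i]

/-- On a regular graph, eigenvectors for eigenvalues other than the degree have zero sum. -/
theorem SimpleGraph.IsRegularOfDegree.sum_eq_zero_of_adjMatrix_mulVec {V : Type*} [Fintype V]
    {Γ : SimpleGraph V} [DecidableRel Γ.Adj] {k : ℕ}
    (hreg : Γ.IsRegularOfDegree k) {θ : ℝ} (hθ : θ ≠ k) {v : V → ℝ}
    (hv : (Γ.adjMatrix ℝ).mulVec v = θ • v) : ∑ i, v i = 0 := by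
  have key : θ * ∑ i, v i = k * ∑ i, v i := by
    calc θ * ∑ i, v i = (fun _ ↦ 1) ⬝ᵥ (Γ.adjMatrix ℝ).mulVec v := by
          rw [hv]
          simp [dotProduct, Finset.mul_sum]
      _ = k * ∑ i, v i := by
          rw [Matrix.dotProduct_mulVec, dotProduct, Finset.mul_sum]
          refine Finset.sum_congr rfl fun i _ ↦ ?_
          rw [SimpleGraph.adjMatrix_vecMul_apply]
          simp [hreg.degree_eq i]
  have : (θ - k) * ∑ i, v i = 0 := by linarith
  exact (mul_eq_zero.1 this).resolve_left (sub_ne_zero.2 hθ)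

theorem Matrix.exists_mulVec_eq_smul_of_mem_spectrum {n : Type*} [Fintype n] [DecidableEq n]
    {A : Matrix n n ℝ} {θ : ℝ} (h : θ ∈ spectrum ℝ A) :
    ∃ v : n → ℝ, v ≠ 0 ∧ A.mulVec v = θ • v := by
  rw [← Matrix.spectrum_toLin', ← Module.End.hasEigenvalue_iff_mem_spectrum] at h
  obtain ⟨v, hv⟩ := h.exists_hasEigenvector
  exact ⟨v, hv.2, by simpa using hv.apply_eq_smul⟩

/-- A real symmetric matrix is annihilated by every polynomial vanishing on its spectrum. -/
theorem Matrix.IsHermitian.aeval_eq_zero {n : Type*} [Fintype n] [DecidableEq n]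
    {A : Matrix n n ℝ} (hA : A.IsHermitian) {p : Polynomial ℝ}
    (hp : ∀ θ ∈ spectrum ℝ A, p.eval θ = 0) : Polynomial.aeval A p = 0 := by
  have hA' : IsSelfAdjoint A := hA
  rw [← cfc_polynomial p A hA', cfc_congr (g := fun _ ↦ 0) hp, cfc_const_zero]

/-- If the cube of the adjacency matrix of a regular graph is a combination of the adjacency matrix,
the all-ones matrix and the identity, then each eigenvalue other than the degree is a root of the
corresponding depressed cubic. -/
theorem SimpleGraph.IsRegularOfDegree.cube_eq_of_mem_spectrum {V : Type*} [Fintype V]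
    [DecidableEq V] {Γ : SimpleGraph V} [DecidableRel Γ.Adj] {k : ℕ}
    (hreg : Γ.IsRegularOfDegree k) {a b c : ℝ}
    (hcube : (Γ.adjMatrix ℝ) ^ 3 = a • Γ.adjMatrix ℝ + b • Matrix.of (fun _ _ ↦ 1) + c • 1)
    {θ : ℝ} (hθ : θ ∈ spectrum ℝ (Γ.adjMatrix ℝ)) (hk : θ ≠ k) : θ ^ 3 = a * θ + c := by
  obtain ⟨v, hv0, hv⟩ := Matrix.exists_mulVec_eq_smul_of_mem_spectrum hθ
  obtain ⟨i, hi⟩ := Function.ne_iff.1 hv0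
  have hs := hreg.sum_eq_zero_of_adjMatrix_mulVec hk hv
  have h3 : ((Γ.adjMatrix ℝ) ^ 3).mulVec v = θ ^ 3 • v := by
    simp only [pow_succ, pow_zero, one_mul, ← Matrix.mulVec_mulVec, hv, Matrix.mulVec_smul,
      smul_smul, mul_assoc]
  have hJ : (Matrix.of (fun _ _ : V ↦ (1 : ℝ))).mulVec v = 0 := by
    ext j
    simpa [Matrix.mulVec, dotProduct] using hs
  rw [hcube, Matrix.add_mulVec, Matrix.add_mulVec, Matrix.smul_mulVec, Matrix.smul_mulVec,
    Matrix.smul_mulVec, hv, hJ, Matrix.one_mulVec] at h3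
  have h := congrFun h3 i
  simp only [Pi.add_apply, Pi.smul_apply, smul_eq_mul, smul_zero, add_zero] at h
  refine mul_right_cancel₀ hi ?_
  linarith

theorem stmt10 {V : Type*} [Fintype V] [DecidableEq V]
    (Γ : SimpleGraph V) [DecidableRel Γ.Adj]
    (hconn : Γ.Connected) (k : ℕ) (hreg : Γ.IsRegularOfDegree k)
    (θ1 θ2 θ3 : ℝ)
    -- the adjacency matrix has exactly the four distinct eigenvalues k > θ1 > θ2 > θ3
    (hspec : spectrum ℝ (Γ.adjMatrix ℝ) = {(k : ℝ), θ1, θ2, θ3})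
    (h1 : θ1 < (k : ℝ)) (h2 : θ2 < θ1) (h3 : θ3 < θ2) :
    -- Γ is a 3-strongly walk-regular graph iff θ1 + θ2 + θ3 = 0
    (∃ lam mu nu : ℝ, ∀ x y : V,
      (Γ.Adj x y → ((Γ.adjMatrix ℝ) ^ 3) x y = lam) ∧
      (x ≠ y → ¬ Γ.Adj x y → ((Γ.adjMatrix ℝ) ^ 3) x y = mu) ∧
      (x = y → ((Γ.adjMatrix ℝ) ^ 3) x y = nu))
    ↔ θ1 + θ2 + θ3 = 0 := by
  constructor
  · rintro ⟨lam, mu, nu, h⟩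
    have hcube : (Γ.adjMatrix ℝ) ^ 3 = (lam - mu) • Γ.adjMatrix ℝ +
        mu • Matrix.of (fun _ _ ↦ 1) + (nu - mu) • 1 := by
      ext x y
      obtain ⟨hadj, hnonadj, hdiag⟩ := h x y
      by_cases hxy : x = y
      · rw [hdiag hxy]
        simp [hxy]
      by_cases hA : Γ.Adj x y
      · rw [hadj hA]
        simp [hxy, hA]
      · rw [hnonadj hxy hA]
        simp [hxy, hA]
    have e1 := hreg.cube_eq_of_mem_spectrum hcube (θ := θ1) (by simp [hspec]) (by linarith)
    have e2 := hreg.cube_eq_of_mem_spectrum hcube (θ := θ2) (by simp [hspec]) (by linarith)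
    have e3 := hreg.cube_eq_of_mem_spectrum hcube (θ := θ3) (by simp [hspec]) (by linarith)
    have d12 : θ1 ^ 2 + θ1 * θ2 + θ2 ^ 2 = lam - mu :=
      mul_left_cancel₀ (sub_ne_zero.2 h2.ne') (by linear_combination e1 - e2)
    have d23 : θ2 ^ 2 + θ2 * θ3 + θ3 ^ 2 = lam - mu :=
      mul_left_cancel₀ (sub_ne_zero.2 h3.ne') (by linear_combination e2 - e3)
    refine mul_left_cancel₀ (sub_ne_zero.2 (h3.trans h2).ne') ?_
    linear_combination d12 - d23
  · intro hsum
    set A := Γ.adjMatrix ℝ with hAdef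
    obtain ⟨e, he⟩ : ∃ e, e = θ1 * θ2 + θ1 * θ3 + θ2 * θ3 := ⟨_, rfl⟩
    obtain ⟨f, hf⟩ : ∃ f, f = θ1 * θ2 * θ3 := ⟨_, rfl⟩
    set B : Matrix V V ℝ := A ^ 3 + e • A - f • 1
    have hAsymm : A.IsSymm := Γ.isSymm_adjMatrix
    have hBsymm : B.IsSymm :=
      ((hAsymm.pow 3).add (hAsymm.smul e)).sub (Matrix.isSymm_one.smul f)
    have hAB : A * B = (k : ℝ) • B := by
      have h0 := Matrix.IsHermitian.aeval_eq_zero (A := A) hAsymm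
        (p := (.X - .C (k : ℝ)) * (.X ^ 3 + .C e * .X - .C f)) (by
          simp only [hspec, Set.mem_insert_iff, Set.mem_singleton_iff]
          rintro θ (hθ | hθ | hθ | hθ) <;>
            simp only [Polynomial.eval_mul, Polynomial.eval_sub, Polynomial.eval_add,
              Polynomial.eval_pow, Polynomial.eval_X, Polynomial.eval_C, he, hf, hθ]
          · ring
          · linear_combination (θ1 - k) * θ1 ^ 2 * hsum
          · linear_combination (θ2 - k) * θ2 ^ 2 * hsum
          · linear_combination (θ3 - k) * θ3 ^ 2 * hsum)
      simp only [map_mul, map_sub, map_add, map_pow, Polynomial.aeval_X, Polynomial.aeval_C,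
        Algebra.algebraMap_eq_smul_one, smul_mul_assoc, one_mul] at h0
      rw [sub_mul, sub_eq_zero, smul_mul_assoc, one_mul] at h0
      exact h0
    have hcol (y x x' : V) : B x y = B x' y :=
      hconn.eq_of_adjMatrix_mulVec_eq_degree hreg (w := fun i ↦ B i y)
        (funext fun i ↦ congrFun (congrFun hAB i) y) x x'
    obtain ⟨z⟩ := hconn.nonempty
    have hconst (x y : V) : B x y = B z z := by
      rw [hcol y x z, hBsymm.apply y z, hcol z y z]
    refine ⟨B z z - e, B z z, B z z + f, fun x y ↦ ?_⟩
    have hxy : (A ^ 3) x y + e * A x y - f * (1 : Matrix V V ℝ) x y = B z z := hconst x y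
    refine ⟨fun h ↦ ?_, fun hne h ↦ ?_, ?_⟩
    · simp [hAdef, h, h.ne] at hxy ⊢
      linarith
    · simpa [hAdef, h, hne] using hxy
    · rintro rfl
      simp [hAdef] at hxy ⊢
      linarith
end

section
/- Let Γ be a connected k-regular finite simple graph whose real adjacency matrix A has exactly four distinct eigenvalues k > θ1 > θ2 > θ3, and let s ≥ 3 be an integer. Then Γ is an s-strongly walk-regular graph if and only if (θ2 − θ3)·θ1^s + (θ3 − θ1)·θ2^s + (θ1 − θ2)·θ3^s = 0. -/
open Polynomial in
/-- A real polynomial vanishes at a symmetric real matrix iff it vanishes on the spectrum. -/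
theorem Matrix.IsSymm.aeval_eq_zero_iff_spectrum {V : Type*} [Fintype V] [DecidableEq V]
    [Nonempty V] {A : Matrix V V ℝ} (hA : A.IsSymm) (q : ℝ[X]) :
    aeval A q = 0 ↔ ∀ t ∈ spectrum ℝ A, q.eval t = 0 := by
  constructor
  · intro h t ht
    have hmem := spectrum.subset_polynomial_aeval A q ⟨t, ht, rfl⟩
    rw [h, spectrum.zero_eq] at hmem
    exact hmem
  · intro h
    have hsa : IsSelfAdjoint A := by
      rw [IsSelfAdjoint, Matrix.star_eq_conjTranspose, Matrix.conjTranspose_eq_transpose_of_trivial]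
      exact hA
    rw [← cfc_polynomial q A hsa, cfc_congr (g := fun _ => 0) h]
    exact cfc_const_zero ℝ A

/-- In a regular graph the matrix `A - k` is the negative of the Laplacian. -/
theorem SimpleGraph.IsRegularOfDegree.adjMatrix_sub_eq_neg_lapMatrix {V : Type*} [Fintype V]
    [DecidableEq V] {Γ : SimpleGraph V} [DecidableRel Γ.Adj] {k : ℕ}
    (hreg : Γ.IsRegularOfDegree k) :
    Γ.adjMatrix ℝ - algebraMap ℝ (Matrix V V ℝ) k = -Γ.lapMatrix ℝ := by
  ext x y
  simp [SimpleGraph.lapMatrix, SimpleGraph.degMatrix, Algebra.algebraMap_eq_smul_one,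
    Matrix.diagonal_apply, Matrix.one_apply, -map_natCast, hreg x]

open Matrix in
/-- For a connected `k`-regular graph, a symmetric matrix is annihilated by `A - k` iff it is
a multiple of the all-ones matrix. -/
theorem SimpleGraph.Connected.adjMatrix_sub_mul_eq_zero_iff {V : Type*} [Fintype V]
    [DecidableEq V] {Γ : SimpleGraph V} [DecidableRel Γ.Adj] (hconn : Γ.Connected) {k : ℕ}
    (hreg : Γ.IsRegularOfDegree k) {M : Matrix V V ℝ} (hM : M.IsSymm) :
    (Γ.adjMatrix ℝ - algebraMap ℝ (Matrix V V ℝ) k) * M = 0 ↔ ∃ c, ∀ x y, M x y = c := by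
  rw [hreg.adjMatrix_sub_eq_neg_lapMatrix, neg_mul, neg_eq_zero]
  have key : Γ.lapMatrix ℝ * M = 0 ↔ ∀ y x x', M x y = M x' y := by
    have hcol : Γ.lapMatrix ℝ * M = 0 ↔ ∀ y, Γ.lapMatrix ℝ *ᵥ M.col y = 0 := by
      constructor
      · intro h y
        ext x
        exact congrFun (congrFun h x) y
      · intro h
        ext x y
        exact congrFun (h y) x
    rw [hcol]
    refine forall_congr' fun y => ?_
    rw [Γ.lapMatrix_mulVec_eq_zero_iff_forall_reachable]
    exact ⟨fun h x x' => h x x' (hconn.preconnected x x'), fun h x x' _ => h x x'⟩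
  rw [key]
  constructor
  · intro h
    obtain ⟨v⟩ := hconn.nonempty
    refine ⟨M v v, fun x y => ?_⟩
    exact (h y x v).trans ((hM.apply y v).trans (h v y v))
  · rintro ⟨c, hc⟩ y x x'
    rw [hc, hc]

theorem stmt11 {V : Type*} [Fintype V] [DecidableEq V]
    (Γ : SimpleGraph V) [DecidableRel Γ.Adj]
    (hconn : Γ.Connected) (k : ℕ) (hreg : Γ.IsRegularOfDegree k)
    (θ1 θ2 θ3 : ℝ)
    -- the adjacency matrix has exactly the four distinct eigenvalues k > θ1 > θ2 > θ3
    (hspec : spectrum ℝ (Γ.adjMatrix ℝ) = {(k : ℝ), θ1, θ2, θ3})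
    (h1 : θ1 < (k : ℝ)) (h2 : θ2 < θ1) (h3 : θ3 < θ2)
    (s : ℕ) (hs : 3 ≤ s) :
    -- Γ is an s-strongly walk-regular graph iff the displayed equation holds
    (∃ lam mu nu : ℝ, ∀ x y : V,
      (Γ.Adj x y → ((Γ.adjMatrix ℝ) ^ s) x y = lam) ∧
      (x ≠ y → ¬ Γ.Adj x y → ((Γ.adjMatrix ℝ) ^ s) x y = mu) ∧
      (x = y → ((Γ.adjMatrix ℝ) ^ s) x y = nu))
    ↔ (θ2 - θ3) * θ1 ^ s + (θ3 - θ1) * θ2 ^ s + (θ1 - θ2) * θ3 ^ s = 0 := by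
  have hne := hconn.nonempty
  set A := Γ.adjMatrix ℝ
  have entry : ∀ x y, A x y = if Γ.Adj x y then 1 else 0 := fun x y =>
    Γ.adjMatrix_apply x y
  have hA : A.IsSymm := Γ.isSymm_adjMatrix
  have affine_iff : ∀ a b : ℝ,
      (∃ c, ∀ x y, (A ^ s - a • A - b • (1 : Matrix V V ℝ)) x y = c) ↔
        θ1 ^ s = a * θ1 + b ∧ θ2 ^ s = a * θ2 + b ∧ θ3 ^ s = a * θ3 + b := by
    intro a b
    have hM : (A ^ s - a • A - b • (1 : Matrix V V ℝ)).IsSymm :=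
      ((hA.pow s).sub (hA.smul a)).sub (Matrix.isSymm_one.smul b)
    rw [← hconn.adjMatrix_sub_mul_eq_zero_iff hreg hM]
    have haeval : Polynomial.aeval A ((Polynomial.X - Polynomial.C (k : ℝ)) *
        (Polynomial.X ^ s - Polynomial.C a * Polynomial.X - Polynomial.C b)) =
        (A - algebraMap ℝ (Matrix V V ℝ) k) * (A ^ s - a • A - b • (1 : Matrix V V ℝ)) := by
      simp only [map_mul, map_sub, map_pow, Polynomial.aeval_X, Polynomial.aeval_C,
        Algebra.algebraMap_eq_smul_one, smul_mul_assoc, one_mul]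
    rw [← haeval, hA.aeval_eq_zero_iff_spectrum, hspec]
    have hk : ∀ t : ℝ, t < k → ((t - k) * (t ^ s - a * t - b) = 0 ↔ t ^ s = a * t + b) := by
      intro t ht
      rw [mul_eq_zero, or_iff_right (sub_ne_zero.2 ht.ne), sub_sub, sub_eq_zero]
    simp [-mul_eq_zero, hk θ1 h1, hk θ2 (h2.trans h1), hk θ3 (h3.trans (h2.trans h1))]
  constructor
  · rintro ⟨lam, mu, nu, h⟩
    obtain ⟨e1, e2, e3⟩ := (affine_iff (lam - mu) (nu - mu)).1 ⟨mu, fun x y => by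
      obtain ⟨hadj, hnadj, heq⟩ := h x y
      rcases eq_or_ne x y with rfl | hxy
      · simp [heq rfl, entry]
      · by_cases hxy' : Γ.Adj x y
        · simp [hadj hxy', entry, hxy, hxy']
        · simp [hnadj hxy hxy', entry, hxy, hxy']⟩
    rw [e1, e2, e3]
    ring
  · intro h
    have h13 : θ1 - θ3 ≠ 0 := sub_ne_zero.2 (h3.trans h2).ne'
    set a := (θ1 ^ s - θ3 ^ s) / (θ1 - θ3)
    have ha' : a * (θ1 - θ3) = θ1 ^ s - θ3 ^ s := div_mul_cancel₀ _ h13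
    obtain ⟨c, hc⟩ := (affine_iff a (θ1 ^ s - a * θ1)).2
      ⟨by ring, mul_left_cancel₀ h13 (by linear_combination (θ1 - θ2) * ha' - h), by
        linear_combination ha'⟩
    refine ⟨a + c, c, θ1 ^ s - a * θ1 + c, fun x y => ⟨fun hxy => ?_, fun hne hxy => ?_, ?_⟩⟩
    · have := hc x y
      simp only [Matrix.sub_apply, Matrix.smul_apply, Matrix.one_apply_ne hxy.ne, smul_eq_mul,
        entry, if_pos hxy] at this
      linear_combination this
    · have := hc x y
      simp only [Matrix.sub_apply, Matrix.smul_apply, Matrix.one_apply_ne hne, smul_eq_mul,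
        entry, if_neg hxy] at this
      linear_combination this
    · rintro rfl
      have := hc x x
      simp only [Matrix.sub_apply, Matrix.smul_apply, Matrix.one_apply_eq, smul_eq_mul,
        entry, if_neg (Γ.loopless.irrefl x)] at this
      linear_combination this
end

section
/- MacWilliams identity for the homogeneous (Lee) weight enumerator of Z4-codes: for every Z4-linear code C ⊆ (ZMod 4)^n and all real numbers X, Y, one has |C⊥| · ∑_{c ∈ C} X^(2n − wt(c)) · Y^(wt(c)) = ∑_{d ∈ C⊥} (X + Y)^(2n − wt(d)) · (X − Y)^(wt(d)), where wt denotes the Lee weight. -/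
/-- The Lee (= homogeneous) weight on `ZMod 4`: wt 0 = 0, wt 1 = wt 3 = 1, wt 2 = 2. -/
def leeWt (x : ZMod 4) : ℕ := if x = 0 then 0 else if x = 2 then 2 else 1

/-- The Lee weight of a vector, extended coordinatewise. -/
def leeWtVec {n : ℕ} (v : Fin n → ZMod 4) : ℕ := ∑ i, leeWt (v i)

/-- Additive characters turn finite sums into products. -/
lemma AddChar.map_finset_sum {A M ι : Type*} [AddCommMonoid A] [CommMonoid M] (ψ : AddChar A M)
    (s : Finset ι) (f : ι → A) : ψ (∑ i ∈ s, f i) = ∏ i ∈ s, ψ (f i) :=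
  map_prod ψ.toMonoidHom (fun i => Multiplicative.ofAdd (f i)) s

open ZMod in
/-- Every complex character of `ZMod N` is a multiplicative shift of the standard one. -/
lemma exists_eq_stdAddChar_mul {N : ℕ} [NeZero N] (ψ : AddChar (ZMod N) ℂ) :
    ∃ a : ZMod N, ∀ x, ψ x = stdAddChar (a * x) := by
  have hbij : Function.Bijective (AddChar.mulShift (stdAddChar (N := N))) := by
    rw [Fintype.bijective_iff_injective_and_card, AddChar.card_eq]
    exact ⟨AddChar.to_mulShift_inj_of_isPrimitive (isPrimitive_stdAddChar N), rfl⟩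
  obtain ⟨a, ha⟩ := hbij.2 ψ
  exact ⟨a, fun x => by rw [← ha, AddChar.mulShift_apply]⟩

open ZMod in
/-- Every complex character of `(ZMod N)^n` is `x ↦ χ (d · x)` for the standard character `χ`. -/
lemma exists_eq_stdAddChar_dotProduct {N n : ℕ} [NeZero N] (ψ : AddChar (Fin n → ZMod N) ℂ) :
    ∃ d : Fin n → ZMod N, ∀ x, ψ x = stdAddChar (∑ i, d i * x i) := by
  choose d hd using fun i => exists_eq_stdAddChar_mul
    (ψ.compAddMonoidHom (AddMonoidHom.single (fun _ : Fin n => ZMod N) i))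
  refine ⟨d, fun x => ?_⟩
  conv_lhs => rw [← Finset.univ_sum_single x]
  rw [AddChar.map_finset_sum, AddChar.map_finset_sum]
  exact Finset.prod_congr rfl fun i _ => hd i (x i)

open ZMod in
/-- A code over `ZMod N` contains every vector orthogonal to its dual. -/
lemma mem_of_forall_mem_dualCode {N n : ℕ} [NeZero N] (C : Submodule (ZMod N) (Fin n → ZMod N))
    {x : Fin n → ZMod N} (hx : ∀ d ∈ dualCode C, ∑ i, d i * x i = 0) : x ∈ C := by
  rw [← Submodule.Quotient.mk_eq_zero]
  have : Finite ((Fin n → ZMod N) ⧸ C) := Finite.of_surjective _ C.mkQ_surjective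
  refine AddChar.forall_apply_eq_zero.1 fun ψ => ?_
  obtain ⟨d, hd⟩ := exists_eq_stdAddChar_dotProduct
    (ψ.compAddMonoidHom C.mkQ.toAddMonoidHom)
  have hd' : ∀ y, ψ (Submodule.Quotient.mk y) = stdAddChar (∑ i, d i * y i) := hd
  rw [hd', hx d, AddChar.map_zero_eq_one]
  intro c hc
  apply injective_stdAddChar
  rw [← hd', (Submodule.Quotient.mk_eq_zero C).2 hc, AddChar.map_zero_eq_one,
    AddChar.map_zero_eq_one]

open ZMod in
/-- A character `d ↦ χ (d · x)` that is nontrivial on a code sums to zero over it. -/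
lemma sum_stdAddChar_eq_zero {N n : ℕ} [NeZero N] (D : Submodule (ZMod N) (Fin n → ZMod N))
    [Fintype D] (x : Fin n → ZMod N) (hx : ∃ d ∈ D, ∑ i, d i * x i ≠ 0) :
    ∑ d : D, (stdAddChar (∑ i, (d : Fin n → ZMod N) i * x i) : ℂ) = 0 := by
  obtain ⟨d, hd, hne⟩ := hx
  have hne' : (stdAddChar (∑ i, d i * x i) : ℂ) ≠ 1 := by
    rw [← AddChar.map_zero_eq_one (stdAddChar (N := N))]
    exact fun h => hne (injective_stdAddChar h)
  refine eq_zero_of_mul_eq_self_left hne' ?_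
  rw [Finset.mul_sum]
  refine Fintype.sum_equiv (Equiv.addLeft (⟨d, hd⟩ : D)) _ _ fun y => ?_
  rw [← AddChar.map_add_eq_mul, ← Finset.sum_add_distrib]
  simp [add_mul]

open ZMod in
/-- Orthogonality relation: summing a character over the dual code detects membership. -/
lemma sum_dualCode_stdAddChar {N n : ℕ} [NeZero N] (C : Submodule (ZMod N) (Fin n → ZMod N))
    [Fintype (dualCode C)] (x : Fin n → ZMod N) [Decidable (x ∈ C)] :
    ∑ d : dualCode C, (stdAddChar (∑ i, (d : Fin n → ZMod N) i * x i) : ℂ) =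
      if x ∈ C then (Fintype.card (dualCode C) : ℂ) else 0 := by
  split_ifs with h
  · have hd (d : dualCode C) : ∑ i, (d : Fin n → ZMod N) i * x i = 0 := d.2 x h
    simp [hd]
  · refine sum_stdAddChar_eq_zero _ x ?_
    by_contra! hx
    exact h (mem_of_forall_mem_dualCode C hx)

open ZMod in
/-- Poisson summation for codes over `ZMod N`. -/
lemma sum_dualCode_fourier {N n : ℕ} [NeZero N] (C : Submodule (ZMod N) (Fin n → ZMod N))
    [Fintype C] [Fintype (dualCode C)] (f : (Fin n → ZMod N) → ℂ) :
    ∑ d : dualCode C, ∑ x, f x * stdAddChar (∑ i, (d : Fin n → ZMod N) i * x i) =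
      (Fintype.card (dualCode C) : ℂ) * ∑ c : C, f c := by
  classical
  rw [Finset.sum_comm]
  simp_rw [← Finset.mul_sum, sum_dualCode_stdAddChar, mul_ite, mul_zero]
  rw [← Finset.sum_filter, ← Finset.sum_mul, mul_comm]
  congr 1
  exact Finset.sum_subtype _ (by simp) _

lemma leeWt_le_two (a : ZMod 4) : leeWt a ≤ 2 := by
  unfold leeWt; split_ifs <;> simp

/-- The weight enumerator monomial of a vector is the product of those of its coordinates. -/
lemma pow_mul_pow_leeWtVec {M : Type*} [CommMonoid M] {n : ℕ} (X Y : M) (v : Fin n → ZMod 4) :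
    X ^ (2 * n - leeWtVec v) * Y ^ leeWtVec v =
      ∏ i, X ^ (2 - leeWt (v i)) * Y ^ leeWt (v i) := by
  have h : 2 * n - leeWtVec v = ∑ i, (2 - leeWt (v i)) := by
    rw [Finset.sum_tsub_distrib _ fun i _ => leeWt_le_two (v i), leeWtVec]
    simp [mul_comm]
  rw [h, leeWtVec, Finset.prod_mul_distrib, Finset.prod_pow_eq_pow_sum,
    Finset.prod_pow_eq_pow_sum]

open ZMod in
lemma stdAddChar_four_one : (stdAddChar (1 : ZMod 4) : ℂ) = Complex.I := by
  have h := stdAddChar_coe (N := 4) 1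
  rw [Int.cast_one] at h
  refine h.trans (Eq.trans ?_ Complex.exp_pi_div_two_mul_I)
  congr 1
  push_cast
  ring

open ZMod in
/-- The Fourier transform of the Lee weight enumerator in length one. -/
lemma sum_leeWt_stdAddChar (X Y : ℂ) (a : ZMod 4) :
    ∑ x : ZMod 4, X ^ (2 - leeWt x) * Y ^ leeWt x * stdAddChar (a * x) =
      (X + Y) ^ (2 - leeWt a) * (X - Y) ^ leeWt a := by
  have h (k : ℕ) : (stdAddChar (k : ZMod 4) : ℂ) = Complex.I ^ k := by
    rw [← stdAddChar_four_one, ← AddChar.map_nsmul_eq_pow, nsmul_one]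
  have h0 : (stdAddChar (0 : ZMod 4) : ℂ) = 1 := AddChar.map_zero_eq_one _
  have h2 : (stdAddChar (2 : ZMod 4) : ℂ) = -1 := by simpa using h 2
  have h3 : (stdAddChar (3 : ZMod 4) : ℂ) = -Complex.I := by simpa using h 3
  have hw0 : leeWt 0 = 0 := rfl
  have hw1 : leeWt 1 = 1 := rfl
  have hw2 : leeWt 2 = 2 := rfl
  have hw3 : leeWt 3 = 1 := rfl
  have hsum (g : ZMod 4 → ℂ) : ∑ x, g x = g 0 + g 1 + g 2 + g 3 := Fin.sum_univ_four g
  have m22 : (2 * 2 : ZMod 4) = 0 := rfl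
  have m23 : (2 * 3 : ZMod 4) = 2 := rfl
  have m32 : (3 * 2 : ZMod 4) = 2 := rfl
  have m33 : (3 * 3 : ZMod 4) = 1 := rfl
  have ha : a = 0 ∨ a = 1 ∨ a = 2 ∨ a = 3 := by revert a; decide
  rw [hsum]
  rcases ha with rfl | rfl | rfl | rfl <;>
    simp only [mul_zero, zero_mul, mul_one, one_mul, m22, m23, m32, m33, hw0, hw1, hw2, hw3,
      h0, stdAddChar_four_one, h2, h3] <;> ring

open ZMod in
/-- The Fourier transform of the Lee weight enumerator. -/
lemma sum_leeWtVec_stdAddChar {n : ℕ} (X Y : ℂ) (d : Fin n → ZMod 4) :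
    ∑ x : Fin n → ZMod 4, X ^ (2 * n - leeWtVec x) * Y ^ leeWtVec x *
        stdAddChar (∑ i, d i * x i) =
      (X + Y) ^ (2 * n - leeWtVec d) * (X - Y) ^ leeWtVec d := by
  simp_rw [pow_mul_pow_leeWtVec, AddChar.map_finset_sum, ← Finset.prod_mul_distrib,
    ← sum_leeWt_stdAddChar]
  exact (Fintype.prod_sum fun i x => X ^ (2 - leeWt x) * Y ^ leeWt x *
    stdAddChar (d i * x)).symm

/-- MacWilliams identity for the homogeneous (Lee) weight enumerator of Z4-codes. -/
theorem stmt13 {n : ℕ} (C : Submodule (ZMod 4) (Fin n → ZMod 4))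
    [Fintype C] [Fintype (dualCode C)] (X Y : ℝ) :
    (Fintype.card (dualCode C) : ℝ) *
        ∑ c : C, X ^ (2 * n - leeWtVec (c : Fin n → ZMod 4)) *
          Y ^ (leeWtVec (c : Fin n → ZMod 4)) =
      ∑ d : dualCode C, (X + Y) ^ (2 * n - leeWtVec (d : Fin n → ZMod 4)) *
        (X - Y) ^ (leeWtVec (d : Fin n → ZMod 4)) := by
  have h := sum_dualCode_fourier C
    fun x => (X : ℂ) ^ (2 * n - leeWtVec x) * (Y : ℂ) ^ leeWtVec x
  simp_rw [sum_leeWtVec_stdAddChar] at h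
  exact_mod_cast h.symm
end

section
/- Second power moment for Z4-codes: let C ⊆ (ZMod 4)^n be a Z4-linear code whose dual C⊥ contains no vector of Lee weight 1, and let B2 = #{d ∈ C⊥ : wt(d) = 2}. Then 2 · ∑_{c ∈ C} wt(c)² = |C| · (B2 + n(2n + 1)), where wt is the Lee weight. -/
/-- The real part of the character `x ↦ I ^ x` of `ZMod 4`. -/
def quarticRe (x : ZMod 4) : ℤ := 1 - leeWt x

theorem two_mul_quarticRe_mul (a b : ZMod 4) :
    2 * (quarticRe a * quarticRe b) = quarticRe (a + b) + quarticRe (a - b) := by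
  revert a b; decide

theorem quarticRe_add_two (a : ZMod 4) : quarticRe (a + 2) = -quarticRe a := by
  revert a; decide

open Classical in
theorem sum_quarticRe_dot {n : ℕ} (C : Submodule (ZMod 4) (Fin n → ZMod 4)) [Fintype C]
    (d : Fin n → ZMod 4) :
    ∑ c : C, quarticRe (∑ i, d i * (c : Fin n → ZMod 4) i) =
      if d ∈ dualCode C then (Fintype.card C : ℤ) else 0 := by
  split_ifs with h
  · have h0 : ∀ c : C, quarticRe (∑ i, d i * (c : Fin n → ZMod 4) i) = 1 := by
      intro c
      rw [h c c.2]
      rfl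
    simp [h0]
  · obtain ⟨c₀, hc₀⟩ : ∃ c₀ : C, ∑ i, d i * (c₀ : Fin n → ZMod 4) i = 2 := by
      have h' : ∃ c ∈ C, ∑ i, d i * c i ≠ 0 := by
        by_contra! hc
        exact h hc
      obtain ⟨c, hc, hne⟩ := h'
      have key : ∀ x : ZMod 4, x ≠ 0 → x = 2 ∨ 2 * x = 2 := by decide
      rcases key _ hne with h2 | h2
      · exact ⟨⟨c, hc⟩, h2⟩
      · refine ⟨⟨(2 : ZMod 4) • c, C.smul_mem _ hc⟩, ?_⟩
        refine Eq.trans ?_ h2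
        rw [Finset.mul_sum]
        exact Finset.sum_congr rfl fun i _ => by simp [mul_left_comm]
    have hshift := Equiv.sum_comp (Equiv.addRight c₀)
      fun c : C => quarticRe (∑ i, d i * (c : Fin n → ZMod 4) i)
    simp only [Equiv.coe_addRight, Submodule.coe_add, Pi.add_apply, mul_add,
      Finset.sum_add_distrib, hc₀, quarticRe_add_two, Finset.sum_neg_distrib] at hshift
    omega

theorem leeWt_eq_zero {x : ZMod 4} : leeWt x = 0 ↔ x = 0 := by
  revert x; decide

theorem leeWtVec_single {n : ℕ} (i : Fin n) (s : ZMod 4) :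
    leeWtVec (Pi.single i s) = leeWt s := by
  rw [leeWtVec, Finset.sum_eq_single i]
  · simp
  · intro k _ hk
    simp [hk, leeWt]
  · simp

theorem leeWtVec_single_add_single {n : ℕ} {i j : Fin n} (hij : i ≠ j) (s t : ZMod 4) :
    leeWtVec (Pi.single i s + Pi.single j t) = leeWt s + leeWt t := by
  rw [leeWtVec, Finset.sum_eq_add_of_mem i j (Finset.mem_univ _) (Finset.mem_univ _) hij]
  · simp [hij, hij.symm]
  · rintro k - ⟨hi, hj⟩
    simp [hi, hj, leeWt]

theorem eq_single_or_eq_single_add_single {n : ℕ} {d : Fin n → ZMod 4} (hd : leeWtVec d = 2) :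
    (∃ i, d = Pi.single i 2) ∨
      ∃ i j, i < j ∧ ∃ s t, leeWt s = 1 ∧ leeWt t = 1 ∧ d = Pi.single i s + Pi.single j t := by
  rw [leeWtVec] at hd
  obtain ⟨i, -, hi⟩ : ∃ i ∈ Finset.univ, leeWt (d i) ≠ 0 :=
    Finset.exists_ne_zero_of_sum_ne_zero (by omega)
  rw [← Finset.add_sum_erase _ _ (Finset.mem_univ i)] at hd
  have cases3 : ∀ x : ZMod 4, leeWt x ≠ 0 → x = 2 ∨ leeWt x = 1 := by decide
  have lee2 : leeWt 2 = 2 := rfl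
  rcases cases3 _ hi with h2 | h1
  · left
    refine ⟨i, funext fun k => ?_⟩
    rw [h2, lee2, Nat.add_eq_left, Finset.sum_eq_zero_iff] at hd
    rcases eq_or_ne k i with rfl | hk
    · simpa using h2
    · simpa [hk] using leeWt_eq_zero.1 (hd k (by simp [hk]))
  · right
    obtain ⟨j, hj, hj0⟩ : ∃ j ∈ Finset.univ.erase i, leeWt (d j) ≠ 0 :=
      Finset.exists_ne_zero_of_sum_ne_zero (by omega)
    rw [← Finset.add_sum_erase _ _ hj, h1] at hd
    have hji : j ≠ i := Finset.ne_of_mem_erase hj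
    have hj1 : leeWt (d j) = 1 := by omega
    have hrest : ∑ k ∈ (Finset.univ.erase i).erase j, leeWt (d k) = 0 := by omega
    rw [Finset.sum_eq_zero_iff] at hrest
    have hd' : d = Pi.single i (d i) + Pi.single j (d j) := by
      funext k
      rcases eq_or_ne k i with rfl | hki
      · simp [hji.symm]
      rcases eq_or_ne k j with rfl | hkj
      · simp [hji]
      · simpa [hki, hkj] using leeWt_eq_zero.1 (hrest k (by simp [hki, hkj]))
    rcases lt_or_gt_of_ne hji with hlt | hlt
    · exact ⟨j, i, hlt, d j, d i, hj1, h1, by rw [add_comm]; exact hd'⟩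
    · exact ⟨i, j, hlt, d i, d j, h1, hj1, hd'⟩

/-- A parametrization of the vectors of Lee weight 2 by triples `(i, j, b)` with `b` true or
`i ≠ j`: up to sign, `e_i + e_j` for `b` true and `e_i - e_j` for `b` false. -/
def weightTwoVec {n : ℕ} (p : Fin n × Fin n × Bool) : Fin n → ZMod 4 :=
  if p.2.2 then
    if p.1 ≤ p.2.1 then Pi.single p.1 1 + Pi.single p.2.1 1
    else Pi.single p.1 (-1) + Pi.single p.2.1 (-1)
  else Pi.single p.1 1 + Pi.single p.2.1 (-1)

theorem weightTwoVec_true_mem {n : ℕ} (D : Submodule (ZMod 4) (Fin n → ZMod 4)) (i j : Fin n) :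
    weightTwoVec (i, j, true) ∈ D ↔ Pi.single i 1 + Pi.single j 1 ∈ D := by
  by_cases h : i ≤ j
  · simp [weightTwoVec, h]
  · rw [← neg_mem_iff (x := Pi.single i 1 + Pi.single j 1)]
    simp [weightTwoVec, h, Pi.single_neg, add_comm]

theorem weightTwoVec_injOn {n : ℕ} :
    Set.InjOn (weightTwoVec (n := n)) {p | p.2.2 = true ∨ p.1 ≠ p.2.1} := by
  have hm : (-1 : ZMod 4) = 3 := rfl
  rintro ⟨i, j, b⟩ hp ⟨i', j', b'⟩ hp' h
  have hi := congrFun h i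
  have hj := congrFun h j
  have hi' := congrFun h i'
  have hj' := congrFun h j'
  simp only [Set.mem_ofPred_eq] at hp hp'
  clear h
  cases b <;> cases b' <;>
    simp only [weightTwoVec, Prod.mk.injEq, hm] at * <;>
    split_ifs at * <;> simp only [Pi.add_apply, Pi.single_apply] at * <;> grind

theorem weightTwoVec_surjOn {n : ℕ} {d : Fin n → ZMod 4} (hd : leeWtVec d = 2) :
    ∃ p : Fin n × Fin n × Bool, (p.2.2 = true ∨ p.1 ≠ p.2.1) ∧ weightTwoVec p = d := by
  rcases eq_single_or_eq_single_add_single hd with ⟨i, rfl⟩ | ⟨i, j, hij, s, t, hs, ht, rfl⟩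
  · exact ⟨(i, i, true), by simp, by simp [weightTwoVec, ← Pi.single_add, one_add_one_eq_two]⟩
  · have key : ∀ x : ZMod 4, leeWt x = 1 → x = 1 ∨ x = -1 := by decide
    rcases key s hs with rfl | rfl <;> rcases key t ht with rfl | rfl
    · exact ⟨(i, j, true), by simp, by simp [weightTwoVec, hij.le]⟩
    · exact ⟨(i, j, false), by simp [hij.ne], by simp [weightTwoVec]⟩
    · exact ⟨(j, i, false), by simp [hij.ne'], by simp [weightTwoVec, add_comm]⟩
    · exact ⟨(j, i, true), by simp, by simp [weightTwoVec, hij.not_ge, add_comm]⟩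

theorem leeWtVec_weightTwoVec {n : ℕ} {p : Fin n × Fin n × Bool}
    (hp : p.2.2 = true ∨ p.1 ≠ p.2.1) : leeWtVec (weightTwoVec p) = 2 := by
  obtain ⟨i, j, b⟩ := p
  rcases eq_or_ne i j with rfl | hij
  · obtain rfl : b = true := by simpa using hp
    simp only [weightTwoVec, if_true, le_refl, ← Pi.single_add, leeWtVec_single]
    rfl
  · simp only [weightTwoVec]
    split_ifs <;> rw [leeWtVec_single_add_single hij] <;> rfl

open Classical in
theorem sum_single_add_sub_single_mem {n : ℕ} (D : Submodule (ZMod 4) (Fin n → ZMod 4))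
    [Fintype D] :
    ∑ i, ∑ j, ((if Pi.single i 1 + Pi.single j 1 ∈ D then 1 else 0) +
        (if Pi.single i 1 - Pi.single j 1 ∈ D then 1 else 0)) =
      Fintype.card {d : D // leeWtVec (d : Fin n → ZMod 4) = 2} + n := by
  have hcard : Fintype.card {d : D // leeWtVec (d : Fin n → ZMod 4) = 2} =
      (Finset.univ.filter fun p : Fin n × Fin n × Bool =>
        (p.2.2 = true ∨ p.1 ≠ p.2.1) ∧ weightTwoVec p ∈ D).card := by
    rw [← Finset.card_univ]
    symm
    refine Finset.card_bij
      (fun p hp => ⟨⟨weightTwoVec p, (Finset.mem_filter.1 hp).2.2⟩,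
        leeWtVec_weightTwoVec (Finset.mem_filter.1 hp).2.1⟩) (fun _ _ => Finset.mem_univ _) ?_ ?_
    · intro p hp q hq h
      simp only [Subtype.mk.injEq] at h
      exact weightTwoVec_injOn (Finset.mem_filter.1 hp).2.1 (Finset.mem_filter.1 hq).2.1 h
    · rintro ⟨⟨d, hdD⟩, hd⟩ -
      obtain ⟨p, hp, rfl⟩ := weightTwoVec_surjOn hd
      exact ⟨p, by simpa using ⟨by simpa using hp, hdD⟩, rfl⟩
  have hdiag : n = ∑ i : Fin n, ∑ j : Fin n, if i = j then 1 else 0 := by simp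
  rw [hcard, Finset.card_filter, Fintype.sum_prod_type]
  refine Eq.trans ?_ (congrArg (_ + ·) hdiag.symm)
  rw [← Finset.sum_add_distrib]
  refine Finset.sum_congr rfl fun i _ => ?_
  rw [Fintype.sum_prod_type, ← Finset.sum_add_distrib]
  refine Finset.sum_congr rfl fun j _ => ?_
  rw [Fintype.sum_bool]
  simp only [true_or, true_and, weightTwoVec_true_mem, add_assoc]
  congr 1
  rcases eq_or_ne i j with rfl | hij
  · simp
  · simp [weightTwoVec, hij, Pi.single_neg, sub_eq_add_neg]

open Classical in
/-- Second power moment for Z4-codes: if the dual code contains no vector of Lee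
weight 1 and `B2` is the number of dual codewords of Lee weight 2, then
`2 ∑_{c ∈ C} wt(c)² = |C| · (B2 + n(2n+1))`. -/
theorem stmt15 {n : ℕ} (C : Submodule (ZMod 4) (Fin n → ZMod 4))
    [Fintype C] [Fintype (dualCode C)]
    (hd : ∀ d ∈ dualCode C, leeWtVec d ≠ 1)
    (B2 : ℕ)
    (hB2 : B2 = Fintype.card {d : dualCode C // leeWtVec (d : Fin n → ZMod 4) = 2}) :
    2 * ∑ c : C, (leeWtVec (c : Fin n → ZMod 4))^2 =
      Fintype.card C * (B2 + n * (2 * n + 1)) := by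
  have hpair : ∀ i j, ∑ c : C, 2 * (quarticRe ((c : Fin n → ZMod 4) i) *
      quarticRe ((c : Fin n → ZMod 4) j)) = (Fintype.card C : ℤ) *
        (((if Pi.single i 1 + Pi.single j 1 ∈ dualCode C then 1 else 0) +
          (if Pi.single i 1 - Pi.single j 1 ∈ dualCode C then 1 else 0) : ℕ) : ℤ) := by
    intro i j
    have hadd := sum_quarticRe_dot C (Pi.single i 1 + Pi.single j 1)
    have hsub := sum_quarticRe_dot C (Pi.single i 1 - Pi.single j 1)
    simp only [Pi.add_apply, Pi.sub_apply, add_mul, sub_mul, Finset.sum_add_distrib,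
      Finset.sum_sub_distrib, Pi.single_apply, ite_mul, one_mul, zero_mul, Finset.sum_ite_eq',
      Finset.mem_univ, if_true] at hadd hsub
    simp only [two_mul_quarticRe_mul, Finset.sum_add_distrib, hadd, hsub]
    push_cast
    simp [mul_add]
  have hfirst : ∀ i, ∑ c : C, quarticRe ((c : Fin n → ZMod 4) i) = 0 := by
    intro i
    have h := sum_quarticRe_dot C (Pi.single i 1)
    rw [if_neg fun hmem => hd _ hmem (leeWtVec_single i 1)] at h
    simpa [Pi.single_apply] using h
  have hwt : ∀ c : C, (leeWtVec (c : Fin n → ZMod 4) : ℤ) =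
      n - ∑ i, quarticRe ((c : Fin n → ZMod 4) i) := by
    intro c
    simp [leeWtVec, quarticRe]
  have hcount := sum_single_add_sub_single_mem (dualCode C)
  have hsq : ∀ c : C, 2 * (leeWtVec (c : Fin n → ZMod 4) : ℤ) ^ 2 =
      2 * (n : ℤ) ^ 2 - 4 * n * ∑ i, quarticRe ((c : Fin n → ZMod 4) i) +
        ∑ i, ∑ j, 2 * (quarticRe ((c : Fin n → ZMod 4) i) *
          quarticRe ((c : Fin n → ZMod 4) j)) := by
    intro c
    simp only [← Finset.mul_sum, ← Finset.sum_mul]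
    rw [hwt]
    ring
  have hlin : ∑ c : C, ∑ i, quarticRe ((c : Fin n → ZMod 4) i) = 0 := by
    rw [Finset.sum_comm]
    exact Finset.sum_eq_zero fun i _ => hfirst i
  have hquad : ∑ c : C, ∑ i, ∑ j, 2 * (quarticRe ((c : Fin n → ZMod 4) i) *
      quarticRe ((c : Fin n → ZMod 4) j)) = (Fintype.card C : ℤ) * ((B2 + n : ℕ) : ℤ) := by
    rw [Finset.sum_comm, hB2]
    simp_rw [Finset.sum_comm (s := (Finset.univ : Finset C)), hpair]
    simp only [← Finset.mul_sum, ← Nat.cast_sum]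
    rw [hcount]
  zify
  rw [Finset.mul_sum, Finset.sum_congr rfl fun c _ => hsq c, Finset.sum_add_distrib,
    Finset.sum_sub_distrib, ← Finset.mul_sum Finset.univ _ (4 * (n : ℤ)), hlin, hquad]
  simp
  ring
end
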